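/- arXiv:1912.07856 — 10 statements merged into one kernel-verified Lean document; each statement's English description precedes it below -/
import Mathlib

section
/- Let A be a complex Banach algebra that is semiprimitive and zero Lie product determined. Then a continuous linear map f : A → A is commuting (i.e., [f(x),x] = 0 for all x ∈ A) if and only if there exist a linear map γ : A → A lying in the centroid of the Lie algebra A⁻ (i.e., γ([x,y]) = [x,γ(y)] = [γ(x),y] for all x,y ∈ A) and a linear map μ : A → Z(A) into the center of A such that f = γ + μ. -/
/-- A complex Banach algebra `A` is *zero Lie product determined* (zLpd) if every
continuous bilinear functional `φ : A × A → ℂ` such that `[x,y] = 0` implies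
`φ (x, y) = 0` is of the form `φ (x, y) = ω [x,y]` for some continuous linear
functional `ω` on `A`.  Here `[x,y] = x*y - y*x`. -/
def IsZeroLieProductDetermined (A : Type*) [NormedRing A] [NormedAlgebra ℂ A] : Prop :=
  ∀ φ : A →L[ℂ] A →L[ℂ] ℂ,
    (∀ x y : A, x * y - y * x = 0 → φ x y = 0) →
    ∃ ω : A →L[ℂ] ℂ, ∀ x y : A, φ x y = ω (x * y - y * x)

/-- A ring with zero Jacobson radical is semiprime. -/
theorem eq_zero_of_forall_mul_mul_eq_zero_of_jacobson_bot {R : Type*} [Ring R]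
    (hR : (⊥ : Ideal R).jacobson = ⊥) {a : R} (ha : ∀ z, a * z * a = 0) : a = 0 := by
  rw [← Ideal.mem_bot, ← hR, Ideal.mem_jacobson_iff]
  intro y
  refine ⟨1 - y * a, ?_⟩
  have h : (1 - y * a) * y * a + (1 - y * a) - 1 = -(y * (a * y * a)) := by noncomm_ring
  rw [h, ha]
  simp

section CommutingMaps

variable {R : Type*} [Ring R] {f : R → R}

/-- For a map with `[f x, y] = [x, f y]`, the biderivation `D x y = [f x, y]` satisfies
`D x y * [u, v] = [x, y] * D u v`. -/
theorem commutator_map_mul_commutator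
    (hf : ∀ x y, f x * y - y * f x = x * f y - f y * x) (x y u v : R) :
    (f x * y - y * f x) * (u * v - v * u) = (x * y - y * x) * (f u * v - v * f u) := by
  have h₁ := hf (x * u) (y * v)
  have h₂ := hf (x * u) y
  have h₃ := hf (x * u) v
  have e₁ := hf x (y * v)
  have e₂ := hf u (y * v)
  have e₃ := hf x y
  have e₄ := hf x v
  have e₅ := hf u y
  have e₆ := hf u v
  -- Expand `D (x * u) (y * v)` by the derivation rule in either variable first.
  have left_first : f (x * u) * (y * v) - y * v * f (x * u)
      = (f x * y - y * f x) * v * u + y * (f x * v - v * f x) * u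
        + x * (f u * y - y * f u) * v + x * y * (f u * v - v * f u) := by
    calc _ = (x * f (y * v) - f (y * v) * x) * u + x * (u * f (y * v) - f (y * v) * u) := by
          rw [h₁]; noncomm_ring
      _ = _ := by rw [← e₁, ← e₂]; noncomm_ring
  have right_first : f (x * u) * (y * v) - y * v * f (x * u)
      = (f x * y - y * f x) * u * v + x * (f u * y - y * f u) * v
        + y * (f x * v - v * f x) * u + y * x * (f u * v - v * f u) := by
    calc _ = (f (x * u) * y - y * f (x * u)) * v + y * (f (x * u) * v - v * f (x * u)) := by
          noncomm_ring
      _ = _ := by rw [h₂, h₃, e₃, e₄, e₅, e₆]; noncomm_ring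
  have key := sub_eq_zero.mpr (right_first.symm.trans left_first)
  rw [← sub_eq_zero, ← key]
  noncomm_ring

theorem commutator_map_mul_mul_commutator
    (hf : ∀ x y, f x * y - y * f x = x * f y - f y * x) (x y z u v : R) :
    (f x * y - y * f x) * z * (u * v - v * u) = (x * y - y * x) * z * (f u * v - v * f u) := by
  have h₁ := commutator_map_mul_commutator hf x y u (z * v)
  have h₂ := commutator_map_mul_commutator hf x y u z
  calc _ = (f x * y - y * f x) * (u * (z * v) - z * v * u)
        - (f x * y - y * f x) * (u * z - z * u) * v := by noncomm_ring
    _ = _ := by rw [h₁, h₂]; noncomm_ring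

theorem commutator_map_eq_zero_of_commute (hR : (⊥ : Ideal R).jacobson = ⊥)
    (hf : ∀ x y, f x * y - y * f x = x * f y - f y * x) {x y : R} (hxy : x * y - y * x = 0) :
    f x * y - y * f x = 0 := by
  refine eq_zero_of_forall_mul_mul_eq_zero_of_jacobson_bot hR fun z => ?_
  rw [commutator_map_mul_mul_commutator hf, hxy, zero_mul, zero_mul]

/-- If `[x, y] ↦ [f x, y]` respects the Jacobi identity, then `f [x, y] - [f x, y]` is central. -/
theorem commutator_map_commutator_sub_eq_zero [IsAddTorsionFree R]
    (hf : ∀ x y, f x * y - y * f x = x * f y - f y * x)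
    (hneg : ∀ x, f (-x) = -f x)
    (hjac : ∀ x y w, (f (x * y - y * x) * w - w * f (x * y - y * x))
      = (f (x * w - w * x) * y - y * f (x * w - w * x))
        + (f x * (y * w - w * y) - (y * w - w * y) * f x))
    (x y w : R) :
    (f (x * y - y * x) - (f x * y - y * f x)) * w
      - w * (f (x * y - y * x) - (f x * y - y * f x)) = 0 := by
  set δ : R → R → R → R := fun x y w => (f (x * y - y * x) - (f x * y - y * f x)) * w
      - w * (f (x * y - y * x) - (f x * y - y * f x)) with hδ
  have symm : ∀ x y w, δ x y w = δ x w y := by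
    intro x y w
    have h := hjac x y w
    simp only [hδ]
    calc _ = (f (x * y - y * x) * w - w * f (x * y - y * x))
          - ((f x * y - y * f x) * w - w * (f x * y - y * f x)) := by noncomm_ring
      _ = _ := by rw [h]; noncomm_ring
  have anti : ∀ x y w, δ x y w = -δ y x w := by
    intro x y w
    have h := hneg (x * y - y * x)
    rw [neg_sub] at h
    simp only [hδ]
    rw [h, hf x y]
    noncomm_ring
  refine self_eq_neg.mp (?_ : δ x y w = _)
  calc δ x y w = -δ y x w := anti ..
    _ = -δ y w x := by rw [symm]
    _ = δ w y x := by rw [anti w]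
    _ = δ w x y := symm ..
    _ = -δ x w y := anti ..
    _ = -δ x y w := by rw [symm x w y]

end CommutingMaps

/-- A linear map killing the kernel of `L` factors through `L`. -/
theorem LinearMap.exists_comp_eq_of_ker_le_ker {K V W U : Type*} [Field K]
    [AddCommGroup V] [Module K V] [AddCommGroup W] [Module K W] [AddCommGroup U] [Module K U]
    (L : V →ₗ[K] W) (N : V →ₗ[K] U) (h : L.ker ≤ N.ker) :
    ∃ ν : W →ₗ[K] U, ∀ v, ν (L v) = N v := by
  obtain ⟨ν, hν⟩ := ((L.ker.liftQ N h).comp L.quotKerEquivRange.symm.toLinearMap).exists_extend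
  refine ⟨ν, fun v => ?_⟩
  have hv := LinearMap.congr_fun hν ⟨L v, v, rfl⟩
  have hs : L.quotKerEquivRange.symm ⟨L v, v, rfl⟩ = L.ker.mkQ v :=
    L.quotKerEquivRange_symm_apply_image v _
  simpa [hs] using hv

/-- In a zero Lie product determined algebra, a continuous bilinear map vanishing on commuting
pairs vanishes on every linear relation between commutators. -/
theorem IsZeroLieProductDetermined.ker_linearCombination_le {A : Type*} [NormedRing A]
    [NormedAlgebra ℂ A] (hA : IsZeroLieProductDetermined A) (B : A →L[ℂ] A →L[ℂ] A)
    (hB : ∀ x y, x * y - y * x = 0 → B x y = 0) :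
    (Finsupp.linearCombination ℂ fun p : A × A => p.1 * p.2 - p.2 * p.1).ker
      ≤ (Finsupp.linearCombination ℂ fun p : A × A => B p.1 p.2).ker := by
  intro s hs
  rw [LinearMap.mem_ker] at hs ⊢
  refine SeparatingDual.eq_zero_of_forall_dual_eq_zero (R := ℂ) fun ω => ?_
  obtain ⟨ω', hω'⟩ := hA ((ContinuousLinearMap.compL ℂ A A ℂ ω).comp B)
    fun x y hxy => by simp [hB x y hxy]
  have h : ∀ x y, ω (B x y) = ω' (x * y - y * x) := hω'
  have hs' := congrArg ω' hs
  rw [Finsupp.linearCombination_apply, map_finsuppSum, map_zero] at hs'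
  rw [Finsupp.linearCombination_apply, map_finsuppSum, ← hs']
  simp only [map_smul, h]

/-- Let `A` be a semiprimitive (zero Jacobson radical) complex Banach
algebra which is zero Lie product determined.  A continuous linear map `f : A → A` is
commuting (`[f x, x] = 0` for all `x`) if and only if `f = γ + μ` where `γ` is a linear
map in the centroid of the Lie algebra `A⁻` (i.e. `γ [x,y] = [x, γ y] = [γ x, y]`)
and `μ` is a linear map into the center of `A`. -/
theorem commuting_continuous_linear_map_iff
    (A : Type*) [NormedRing A] [NormedAlgebra ℂ A] [CompleteSpace A]
    (hsp : (⊥ : Ideal A).jacobson = ⊥)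
    (hzlpd : IsZeroLieProductDetermined A)
    (f : A →L[ℂ] A) :
    (∀ x : A, f x * x - x * f x = 0) ↔
      ∃ (γ μ : A →ₗ[ℂ] A),
        (∀ x y : A,
            γ (x * y - y * x) = x * γ y - γ y * x ∧
            γ (x * y - y * x) = γ x * y - y * γ x) ∧
        (∀ x : A, μ x ∈ Set.center A) ∧
        (∀ x : A, f x = γ x + μ x) := by
  constructor
  · intro hf
    have hlin : ∀ x y, f x * y - y * f x = x * f y - f y * x := by
      intro x y
      have h := hf (x + y)
      have hx := hf x
      have hy := hf y
      rw [map_add] at h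
      rw [← sub_eq_zero]
      calc _ = ((f x + f y) * (x + y) - (x + y) * (f x + f y))
            - (f x * x - x * f x) - (f y * y - y * f y) := by noncomm_ring
        _ = 0 := by rw [h, hx, hy]; simp
    let B : A →L[ℂ] A →L[ℂ] A :=
      (ContinuousLinearMap.mul ℂ A - (ContinuousLinearMap.mul ℂ A).flip).comp f
    have hB : ∀ x y, B x y = f x * y - y * f x := fun _ _ => rfl
    let L : (A × A →₀ ℂ) →ₗ[ℂ] A :=
      Finsupp.linearCombination ℂ fun p : A × A => p.1 * p.2 - p.2 * p.1
    let M : (A × A →₀ ℂ) →ₗ[ℂ] A := Finsupp.linearCombination ℂ fun p : A × A => B p.1 p.2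
    have hker : L.ker ≤ M.ker := hzlpd.ker_linearCombination_le B fun x y hxy =>
      commutator_map_eq_zero_of_commute hsp hlin hxy
    obtain ⟨γ₀, hγ₀⟩ := L.exists_comp_eq_of_ker_le_ker M hker
    have hγ₀c : ∀ x y, γ₀ (x * y - y * x) = f x * y - y * f x := by
      intro x y
      simpa [L, M, hB] using hγ₀ (Finsupp.single (x, y) 1)
    have hcent : ∀ x y, (f x * y - y * f x) - f (x * y - y * x) ∈
        Subalgebra.toSubmodule (Subalgebra.center ℂ A) := by
      intro x y
      rw [Subalgebra.mem_toSubmodule, Subalgebra.mem_center_iff]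
      intro w
      have : IsAddTorsionFree A := .of_isTorsionFree ℂ A
      have h := commutator_map_commutator_sub_eq_zero hlin (map_neg f) ?_ x y w
      · rw [← sub_eq_zero, ← h]
        noncomm_ring
      · intro x y w
        rw [← hγ₀c, ← hγ₀c, ← hγ₀c, ← map_add]
        congr 1
        noncomm_ring
    have hN : ∀ s, (M - f.toLinearMap ∘ₗ L) s ∈
        Subalgebra.toSubmodule (Subalgebra.center ℂ A) := by
      intro s
      induction s using Finsupp.induction_linear with
      | zero => simp
      | add s t hs ht => rw [map_add]; exact add_mem hs ht
      | single p c =>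
        have h := Submodule.smul_mem _ c (hcent p.1 p.2)
        simpa [L, M, hB, smul_sub] using h
    obtain ⟨ν, hν⟩ := L.exists_comp_eq_of_ker_le_ker
      ((M - f.toLinearMap ∘ₗ L).codRestrict _ hN) fun s hs => by
        have hs' := hker hs
        rw [LinearMap.mem_ker] at hs hs' ⊢
        ext
        simp [hs, hs']
    have hνc : ∀ x y, (ν (x * y - y * x) : A) = (f x * y - y * f x) - f (x * y - y * x) := by
      intro x y
      have h := congrArg Subtype.val (hν (Finsupp.single (x, y) 1))
      simpa [L, M, hB] using h
    have hcomm : ∀ x w, w * (ν x : A) = (ν x : A) * w := fun x =>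
      (Subalgebra.mem_center_iff (R := ℂ)).mp (ν x).2
    refine ⟨f.toLinearMap + Submodule.subtype _ ∘ₗ ν, -(Submodule.subtype _ ∘ₗ ν), ?_, ?_, ?_⟩
    · intro x y
      have e : (f.toLinearMap + Submodule.subtype _ ∘ₗ ν) (x * y - y * x)
          = f x * y - y * f x := by
        change f (x * y - y * x) + (ν (x * y - y * x) : A) = _
        rw [hνc]; abel
      rw [e]
      refine ⟨?_, ?_⟩
      · change _ = x * (f y + (ν y : A)) - (f y + (ν y : A)) * x
        rw [hlin, mul_add, add_mul, hcomm]; abel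
      · change _ = (f x + (ν x : A)) * y - y * (f x + (ν x : A))
        rw [mul_add, add_mul, hcomm]; abel
    · intro x
      exact neg_mem (S := Submodule ℂ A) (ν x).2
    · intro x
      simp
  · rintro ⟨γ, μ, hγ, hμ, hf⟩ x
    have h := (hγ x x).2
    have hc := (hμ x).comm x
    rw [sub_self, map_zero] at h
    rw [hf, add_mul, mul_add, hc.eq, add_sub_add_right_eq_sub, ← h]
end

section
/- Let A be a complex Banach algebra that is semiprimitive and zero Lie product determined, let Q be a unital ring containing A (via an injective ring homomorphism) such that A is a 3-free subset of Q, and let d be a nonzero derivation of A. Then there exist x, y ∈ A such that [x,y] = 0 and [d(x),d(y)] ≠ 0. -/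
/-- A function `g` of an `m`-tuple is independent of the `i`-th coordinate; this encodes
a map defined on the tuples `x̄ₘ^i` with the `i`-th entry omitted. -/
def IndepOfCoord {Q : Type*} {m : ℕ} (g : (Fin m → Q) → Q) (i : Fin m) : Prop :=
  ∀ x y : Fin m → Q, (∀ k, k ≠ i → x k = y k) → g x = g y

/-- A function `g` of an `m`-tuple is independent of the `i`-th and `j`-th coordinates;
this encodes a map defined on the tuples `x̄ₘ^{ij}` with the `i`-th and `j`-th entries
omitted. -/
def IndepOfCoord2 {Q : Type*} {m : ℕ} (g : (Fin m → Q) → Q) (i j : Fin m) : Prop :=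
  ∀ x y : Fin m → Q, (∀ k, k ≠ i → k ≠ j → x k = y k) → g x = g y

/-- The maps `E i` (for `i ∈ I`) and `F j` (for `j ∈ J`), defined on `(m-1)`-tuples from
`R` (encoded as functions of full `m`-tuples that are independent of the omitted
coordinate), admit a *standard solution*: there are maps `p i j : R^{m-2} → Q` and
central-valued maps `λ k : R^{m-1} → Z(Q)` with `λ k = 0` for `k ∉ I ∩ J`, such that
`E i x̄ₘ^i = ∑_{j ∈ J, j ≠ i} x j * p i j x̄ₘ^{ij} + λ i x̄ₘ^i` and
`F j x̄ₘ^j = -∑_{i ∈ I, i ≠ j} p i j x̄ₘ^{ij} * x i - λ j x̄ₘ^j` on tuples from `R`. -/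
def IsStandardSolution {Q : Type*} [Ring Q] (R : Set Q) {m : ℕ}
    (I J : Finset (Fin m)) (E F : Fin m → (Fin m → Q) → Q) : Prop :=
  ∃ (p : Fin m → Fin m → (Fin m → Q) → Q) (lam : Fin m → (Fin m → Q) → Q),
    (∀ i ∈ I, ∀ j ∈ J, i ≠ j → IndepOfCoord2 (p i j) i j) ∧
    (∀ k ∈ I ∪ J, IndepOfCoord (lam k) k) ∧
    (∀ k, ∀ x : Fin m → Q, lam k x ∈ Set.center Q) ∧
    (∀ k, k ∉ I ∩ J → lam k = 0) ∧
    (∀ i ∈ I, ∀ x : Fin m → Q, (∀ k, x k ∈ R) →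
        E i x = (∑ j ∈ J.erase i, x j * p i j x) + lam i x) ∧
    (∀ j ∈ J, ∀ x : Fin m → Q, (∀ k, x k ∈ R) →
        F j x = -(∑ i ∈ I.erase j, p i j x * x i) - lam j x)

/-- `R` is a *d-free subset* of the unital ring `Q` if for all `m ≥ 1`, all index sets
`I, J ⊆ {1, …, m}` and all maps `E i, F j : R^{m-1} → Q`:
(a) if `max (|I|, |J|) ≤ d` and `∑_{i ∈ I} E i (x̄ₘ^i) * x i + ∑_{j ∈ J} x j * F j (x̄ₘ^j) = 0`
for all `x̄ₘ ∈ R^m`, then a standard solution exists; and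
(b) if `max (|I|, |J|) ≤ d - 1` and the same sum lies in `Z(Q)` for all `x̄ₘ ∈ R^m`,
then a standard solution exists. -/
def IsDFreeSubset {Q : Type*} [Ring Q] (R : Set Q) (d : ℕ) : Prop :=
  ∀ (m : ℕ), 0 < m → ∀ (I J : Finset (Fin m)) (E F : Fin m → (Fin m → Q) → Q),
    (∀ i ∈ I, IndepOfCoord (E i) i) → (∀ j ∈ J, IndepOfCoord (F j) j) →
    ((max I.card J.card ≤ d →
        (∀ x : Fin m → Q, (∀ k, x k ∈ R) →
          (∑ i ∈ I, E i x * x i) + ∑ j ∈ J, x j * F j x = 0) →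
        IsStandardSolution R I J E F) ∧
     (max I.card J.card ≤ d - 1 →
        (∀ x : Fin m → Q, (∀ k, x k ∈ R) →
          ((∑ i ∈ I, E i x * x i) + ∑ j ∈ J, x j * F j x) ∈ Set.center Q) →
        IsStandardSolution R I J E F))

open Filter Topology

/-- In a semiprimitive ring, an element generating a left ideal of square-zero elements is zero. -/
theorem eq_zero_of_forall_mul_sq_eq_zero {A : Type*} [Ring A]
    (hsp : (⊥ : Ideal A).jacobson = ⊥) {s : A} (h : ∀ y : A, y * s * (y * s) = 0) : s = 0 := by
  have hs : s ∈ (⊥ : Ideal A).jacobson := by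
    rw [Ideal.mem_jacobson_iff]
    intro y
    refine ⟨1 - y * s, ?_⟩
    rw [Ideal.mem_bot]
    have : (1 - y * s) * y * s + (1 - y * s) - 1 = -(y * s * (y * s)) := by noncomm_ring
    rw [this, h, neg_zero]
  rwa [hsp, Ideal.mem_bot] at hs

/-- A semiprimitive unital ring is semiprime. -/
theorem eq_zero_of_forall_mul_mul_eq_zero {A : Type*} [Ring A]
    (hsp : (⊥ : Ideal A).jacobson = ⊥) {s : A} (h : ∀ y : A, s * y * s = 0) : s = 0 :=
  eq_zero_of_forall_mul_sq_eq_zero hsp fun y => by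
    rw [show y * s * (y * s) = y * (s * y * s) by noncomm_ring, h, mul_zero]

/-- In a semiprimitive ring, if `y` commutes with every element of `s A s`, then it commutes
with `s`. -/
theorem commute_of_forall_commute_mul_mul {A : Type*} [Ring A]
    (hsp : (⊥ : Ideal A).jacobson = ⊥) {s y : A} (h : ∀ w : A, y * (s * w * s) = s * w * s * y) :
    s * y = y * s := by
  have key (w v : A) : s * w * (s * y - y * s) * v * s = 0 := by
    have h₁ := h (w * s * v)
    have h₂ := h v
    have h₃ := h w
    have e₁ : s * w * s * y * v * s = y * (s * w * s) * v * s := by rw [h₃]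
    have e₂ : s * w * y * s * v * s = s * w * (s * v * s * y) := by rw [← h₂]; noncomm_ring
    calc s * w * (s * y - y * s) * v * s
        = s * w * s * y * v * s - s * w * y * s * v * s := by noncomm_ring
      _ = y * (s * (w * s * v) * s) - s * (w * s * v) * s * y := by
          rw [e₁, e₂]; noncomm_ring
      _ = 0 := by rw [h₁, sub_self]
  have key' (w : A) : s * w * (s * y - y * s) = 0 :=
    eq_zero_of_forall_mul_mul_eq_zero hsp fun v => by
      rw [show s * w * (s * y - y * s) * v * (s * w * (s * y - y * s))
        = (s * w * (s * y - y * s) * v * s) * (w * (s * y - y * s)) by noncomm_ring, key, zero_mul]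
  have : s * y - y * s = 0 := eq_zero_of_forall_mul_mul_eq_zero hsp fun w => by
    rw [show (s * y - y * s) * w * (s * y - y * s)
      = s * (y * w) * (s * y - y * s) - y * (s * w * (s * y - y * s)) by noncomm_ring,
      key', key', mul_zero, sub_zero]
  exact sub_eq_zero.mp this

section FunctionalIdentities

variable {A Q : Type*} [Ring A] [Ring Q] {ι : A →+* Q}

/-- In a `3`-free subring, a central element `c` with `c [x, y]` central for all `x, y` is zero. -/
theorem eq_zero_of_mul_commutator_central (hι : Function.Injective ι)
    (hfree : IsDFreeSubset (Set.range ι) 3) {c : A} (hc : ∀ x, x * c = c * x)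
    (h : ∀ x y z : A, z * (c * (x * y - y * x)) = c * (x * y - y * x) * z) : c = 0 := by
  set g : Q → A := Function.invFun ι
  have hg (a : A) : g (ι a) = a := Function.leftInverse_invFun hι a
  obtain ⟨p, lam, -, -, -, hlam, -, hF⟩ := (hfree 3 (by norm_num) ∅ Finset.univ (fun _ _ => 0)
    ![fun x => ι (c * g (x 1) * g (x 2)), fun x => -ι (c * g (x 0) * g (x 2)),
      fun x => ι (c * (g (x 1) * g (x 0) - g (x 0) * g (x 1)))]
    (by simp) (by
      intro j _ x y hxy
      fin_cases j <;> simp [hxy])).1 (by simp) (by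
      intro x hx
      choose a ha using hx
      obtain rfl : (fun k => ι (a k)) = x := funext ha
      have h₁ := congrArg ι (h (a 0) (a 1) (a 2))
      have e₀ : a 0 * (c * a 1 * a 2) = c * a 0 * a 1 * a 2 := by
        rw [← mul_assoc, ← mul_assoc, hc]
      have e₁ : a 1 * (c * a 0 * a 2) = c * a 1 * a 0 * a 2 := by
        rw [← mul_assoc, ← mul_assoc, hc]
      simp only [Fin.sum_univ_three, Finset.sum_empty, zero_add, Matrix.cons_val, hg,
        ← map_mul, mul_neg, ← map_neg, ← map_add]
      rw [e₀, e₁, show a 2 * (c * (a 1 * a 0 - a 0 * a 1))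
        = -(a 2 * (c * (a 0 * a 1 - a 1 * a 0))) by noncomm_ring, h,
        ← map_zero ι]
      congr 1
      noncomm_ring)
  have := hF 0 (Finset.mem_univ _) (fun _ => ι 1) (fun _ => ⟨1, rfl⟩)
  rw [hlam 0 (by simp)] at this
  simp only [Matrix.cons_val, hg, Finset.erase_empty, Finset.sum_empty] at this
  apply hι
  simpa using this

/-- In a `3`-free subring, the identity `x F(y) + y G(x) ∈ Z(Q)` forces `F = 0`. -/
theorem eq_zero_of_left_identity_mem_center (hι : Function.Injective ι)
    (hfree : IsDFreeSubset (Set.range ι) 3) {F G : A → Q}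
    (h : ∀ x y : A, ι x * F y + ι y * G x ∈ Set.center Q) (y : A) : F y = 0 := by
  set g : Q → A := Function.invFun ι
  have hg (a : A) : g (ι a) = a := Function.leftInverse_invFun hι a
  obtain ⟨p, lam, -, -, -, hlam, -, hF⟩ := (hfree 2 (by norm_num) ∅ Finset.univ (fun _ _ => 0)
    ![fun x => F (g (x 1)), fun x => G (g (x 0))]
    (by simp) (by
      intro j _ x y hxy
      fin_cases j <;> simp [hxy])).2 (by simp) (by
      intro x hx
      choose a ha using hx
      obtain rfl : (fun k => ι (a k)) = x := funext ha
      simpa [hg] using h (a 0) (a 1))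
  have := hF 0 (Finset.mem_univ _) (fun _ => ι y) (by simp)
  rw [hlam 0 (by simp)] at this
  simpa [hg] using this

/-- A commuting derivation of a `3`-free subring is zero. -/
theorem derivation_eq_zero_of_commuting (hι : Function.Injective ι)
    (hfree : IsDFreeSubset (Set.range ι) 3) (d : A →+ A)
    (hleib : ∀ x y : A, d (x * y) = d x * y + x * d y)
    (hcomm : ∀ x, d x * x = x * d x) (x : A) : d x = 0 := by
  set g : Q → A := Function.invFun ι
  have hg (a : A) : g (ι a) = a := Function.leftInverse_invFun hι a
  have hlin (x y : A) : x * d y + y * d x = d y * x + d x * y := by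
    have h := hcomm (x + y)
    rw [map_add] at h
    have hx := hcomm x
    have hy := hcomm y
    linear_combination (norm := noncomm_ring) hx + hy - h
  obtain ⟨p, lam, hp, -, hlam, -, -, hF⟩ := (hfree 2 (by norm_num) Finset.univ Finset.univ
    ![fun x => -ι (d (g (x 1))), fun x => -ι (d (g (x 0)))]
    ![fun x => ι (d (g (x 1))), fun x => ι (d (g (x 0)))]
    (by
      intro j _ x y hxy
      fin_cases j <;> simp [hxy]) (by
      intro j _ x y hxy
      fin_cases j <;> simp [hxy])).1 (by simp) (by
      intro x hx
      choose a ha using hx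
      obtain rfl : (fun k => ι (a k)) = x := funext ha
      have := congrArg ι (hlin (a 0) (a 1))
      simp only [map_add, map_mul] at this
      simp only [Fin.sum_univ_two, Matrix.cons_val, hg]
      rw [this]
      noncomm_ring)
  set q : Q := p 1 0 0
  set l : A → Q := fun y => lam 0 (fun _ => ι y)
  have hform (y : A) : ι (d y) = -(q * ι y) - l y := by
    have h := hF 0 (Finset.mem_univ _) (fun _ => ι y) (by simp)
    have hq : p 1 0 (fun _ => ι y) = q :=
      hp 1 (Finset.mem_univ _) 0 (Finset.mem_univ _) (by simp) _ _
        (by intro k; fin_cases k <;> simp)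
    have he : (Finset.univ : Finset (Fin 2)).erase 0 = {1} := by decide
    simpa [hg, he, hq] using h
  have hl (y : A) : l y ∈ Set.center Q := hlam _ _
  have hzero := eq_zero_of_left_identity_mem_center hι hfree
    (F := fun z => ι (d z)) (G := fun y => - l y) (fun y z => by
      have h := congrArg ι (hleib y z)
      rw [hform, map_add, map_mul, map_mul, map_mul, hform y] at h
      have hc : l y * ι z = ι z * l y := (Set.mem_center_iff.mp (hl y)).comm _
      have : ι y * ι (d z) + ι z * -l y = -l (y * z) := by
        rw [sub_mul, hc] at h
        linear_combination (norm := noncomm_ring) -h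
      rw [this]
      exact Set.neg_mem_center (hl _))
  exact hι (by rw [hzero, map_zero])

/-- The functional identity `[x, dy dz] + [y, dz dx] + [z, dx dy] = 0` on a `3`-free subring
describes the products `dx dy`. -/
theorem exists_standard_form_of_cyclic_identity (hι : Function.Injective ι)
    (hfree : IsDFreeSubset (Set.range ι) 3) (d : A → A)
    (h : ∀ x y z : A, x * (d y * d z) + y * (d z * d x) + z * (d x * d y)
      = d y * d z * x + d z * d x * y + d x * d y * z) :
    ∃ (p q : A → Q) (l : A → A → Q), (∀ x y, l x y ∈ Set.center Q) ∧
      ∀ x y, ι (d x * d y) = ι x * p y + ι y * q x + l x y := by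
  set g : Q → A := Function.invFun ι
  have hg (a : A) : g (ι a) = a := Function.leftInverse_invFun hι a
  obtain ⟨p, lam, hp, -, hlam, -, hE, -⟩ := (hfree 3 (by norm_num) Finset.univ Finset.univ
    ![fun x => -ι (d (g (x 1)) * d (g (x 2))), fun x => -ι (d (g (x 2)) * d (g (x 0))),
      fun x => -ι (d (g (x 0)) * d (g (x 1)))]
    ![fun x => ι (d (g (x 1)) * d (g (x 2))), fun x => ι (d (g (x 2)) * d (g (x 0))),
      fun x => ι (d (g (x 0)) * d (g (x 1)))]
    (by
      intro j _ x y hxy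
      fin_cases j <;> simp [hxy]) (by
      intro j _ x y hxy
      fin_cases j <;> simp [hxy])).1 (by simp) (by
      intro x hx
      choose a ha using hx
      obtain rfl : (fun k => ι (a k)) = x := funext ha
      simp only [Fin.sum_univ_three, Matrix.cons_val, hg, ← map_mul, neg_mul, ← map_neg, ← map_add]
      rw [h, ← map_zero ι]
      congr 1
      abel)
  refine ⟨fun y => -p 2 0 ![0, ι y, 0], fun x => -p 2 1 ![ι x, 0, 0],
    fun x y => -lam 2 ![ι x, ι y, 0], fun x y => Set.neg_mem_center (hlam _ _), fun x y => ?_⟩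
  have h₂ := hE 2 (Finset.mem_univ _) ![ι x, ι y, 0]
    (by
      intro k
      fin_cases k
      exacts [⟨x, rfl⟩, ⟨y, rfl⟩, ⟨0, map_zero ι⟩])
  have hp₀ : p 2 0 ![ι x, ι y, 0] = p 2 0 ![0, ι y, 0] :=
    hp 2 (Finset.mem_univ _) 0 (Finset.mem_univ _) (by decide) _ _
      (by intro k; fin_cases k <;> simp)
  have hp₁ : p 2 1 ![ι x, ι y, 0] = p 2 1 ![ι x, 0, 0] :=
    hp 2 (Finset.mem_univ _) 1 (Finset.mem_univ _) (by decide) _ _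
      (by intro k; fin_cases k <;> simp)
  have he : (Finset.univ : Finset (Fin 3)).erase 2 = {0, 1} := by decide
  rw [he, Finset.sum_pair (by decide), hp₀, hp₁] at h₂
  simp only [Matrix.cons_val, hg] at h₂
  rw [← neg_neg (ι _), h₂]
  noncomm_ring

/-- If `[x, dy dz] + [y, dz dx] + [z, dx dy] = 0` for a derivation `d` of a `3`-free subring, then
every `dy w dy` commutes with `y`. -/
theorem commute_derivation_mul_mul_derivation (hι : Function.Injective ι)
    (hfree : IsDFreeSubset (Set.range ι) 3) (d : A →+ A)
    (hleib : ∀ x y : A, d (x * y) = d x * y + x * d y)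
    (h : ∀ x y z : A, x * (d y * d z) + y * (d z * d x) + z * (d x * d y)
      = d y * d z * x + d z * d x * y + d x * d y * z) (y w : A) :
    y * (d y * w * d y) = d y * w * d y * y := by
  obtain ⟨p, q, l, hl, hf⟩ := exists_standard_form_of_cyclic_identity hι hfree d h
  have hd1 : d 1 = 0 := by simpa using hleib 1 1
  have hq (x : A) : q x = -(ι x * p 1) - l x 1 := by
    have := hf x 1
    rw [hd1, mul_zero, map_zero, map_one, one_mul] at this
    linear_combination (norm := noncomm_ring) -this
  have hform : ι (d y * w * d y) = ι y * -l (y * w) 1 + ι y * ι y * l w 1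
      + l (y * w) y - ι y * l w y := by
    have e : d y * w * d y = d (y * w) * d y - y * (d w * d y) := by rw [hleib]; noncomm_ring
    rw [e, map_sub, map_mul ι y, hf, hf, hq, hq, map_mul]
    noncomm_ring
  have hc (a b : A) : Commute (ι y) (l a b) := ((Set.mem_center_iff.mp (hl a b)).comm _).symm
  have hy : Commute (ι y) (ι y) := Commute.refl _
  apply hι
  rw [map_mul, map_mul ι _ y, hform]
  exact (((hy.mul_right (hc _ _).neg_right).add_right
    ((hy.mul_right hy).mul_right (hc _ _))).add_right (hc _ _)).sub_right (hy.mul_right (hc _ _))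

end FunctionalIdentities

section Continuity

variable {A : Type*} [NormedRing A] [NormedAlgebra ℂ A]

/-- Membership in the separating space of a linear map `d`. -/
def IsSeparating (d : A →ₗ[ℂ] A) (s : A) : Prop :=
  ∃ u : ℕ → A, Tendsto u atTop (𝓝 0) ∧ Tendsto (fun n => d (u n)) atTop (𝓝 s)

theorem IsSeparating.add {d : A →ₗ[ℂ] A} {s t : A} (hs : IsSeparating d s)
    (ht : IsSeparating d t) : IsSeparating d (s + t) := by
  obtain ⟨u, hu, hdu⟩ := hs
  obtain ⟨v, hv, hdv⟩ := ht
  exact ⟨fun n => u n + v n, by simpa using hu.add hv, by simpa using hdu.add hdv⟩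

theorem IsSeparating.mul_left {d : A →ₗ[ℂ] A} (hleib : ∀ x y : A, d (x * y) = d x * y + x * d y)
    {s : A} (hs : IsSeparating d s) (a : A) : IsSeparating d (a * s) := by
  obtain ⟨u, hu, hdu⟩ := hs
  exact ⟨fun n => a * u n, by simpa using hu.const_mul a,
    by simpa [hleib] using (hu.const_mul (d a)).add (hdu.const_mul a)⟩

theorem IsSeparating.mul_right {d : A →ₗ[ℂ] A} (hleib : ∀ x y : A, d (x * y) = d x * y + x * d y)
    {s : A} (hs : IsSeparating d s) (a : A) : IsSeparating d (s * a) := by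
  obtain ⟨u, hu, hdu⟩ := hs
  exact ⟨fun n => u n * a, by simpa using hu.mul_const a,
    by simpa [hleib] using (hdu.mul_const a).add (hu.mul_const (d a))⟩

/-- If `(dx)²` commutes with `x` for all `x`, then squares in the separating space of the
derivation `d` are central. -/
theorem IsSeparating.commute_sq {d : A →ₗ[ℂ] A}
    (hleib : ∀ x y : A, d (x * y) = d x * y + x * d y)
    (hsq : ∀ x : A, x * (d x * d x) = d x * d x * x) {s : A} (hs : IsSeparating d s) (x : A) :
    x * (s * s) = s * s * x := by
  have key {s : A} (hs : IsSeparating d s) :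
      x * ((d x + s) * (d x + s)) = (d x + s) * (d x + s) * x := by
    obtain ⟨u, hu, hdu⟩ := hs
    have hx : Tendsto (fun n => x + u n) atTop (𝓝 x) := by simpa using hu.const_add x
    have hdx : Tendsto (fun n => d (x + u n)) atTop (𝓝 (d x + s)) := by
      simpa using hdu.const_add (d x)
    refine tendsto_nhds_unique (hx.mul (hdx.mul hdx)) ?_
    simpa only [hsq] using (hdx.mul hdx).mul hx
  have h₁ := key hs
  have h₂ := key (hs.mul_left hleib (-1))
  have h₃ := hsq x
  have h₄ : (2 : ℂ) • (x * (s * s)) = (2 : ℂ) • (s * s * x) := by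
    rw [two_smul, two_smul]
    linear_combination (norm := noncomm_ring) h₁ + h₂ - 2 * h₃
  exact smul_right_injective A two_ne_zero h₄

/-- A derivation `d` of a semiprimitive Banach algebra embedded as a `3`-free subset is continuous
as soon as `(dx)²` commutes with `x` for all `x`. -/
theorem continuous_of_commute_sq [CompleteSpace A] {Q : Type*} [Ring Q]
    (hsp : (⊥ : Ideal A).jacobson = ⊥) {ι : A →+* Q} (hι : Function.Injective ι)
    (hfree : IsDFreeSubset (Set.range ι) 3) {d : A →ₗ[ℂ] A}
    (hleib : ∀ x y : A, d (x * y) = d x * y + x * d y)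
    (hsq : ∀ x : A, x * (d x * d x) = d x * d x * x) : Continuous d := by
  have hsymm {s t : A} (hs : IsSeparating d s) (ht : IsSeparating d t) (x : A) :
      x * (s * t + t * s) = (s * t + t * s) * x := by
    have h₁ := hs.commute_sq hleib hsq x
    have h₂ := ht.commute_sq hleib hsq x
    have h₃ := (hs.add ht).commute_sq hleib hsq x
    linear_combination (norm := noncomm_ring) h₃ - h₁ - h₂
  have hnil {s : A} (hs : IsSeparating d s) : s * s = 0 := by
    have hc := hs.commute_sq hleib hsq
    refine eq_zero_of_mul_commutator_central hι hfree hc fun x y z => ?_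
    have h₁ := hsymm hs (hs.mul_right hleib (x * y)) z
    have h₂ := hsymm (hs.mul_right hleib x) (hs.mul_left hleib y) z
    have e : s * s * (x * y - y * x)
        = (s * (s * (x * y)) + s * (x * y) * s) - (s * x * (y * s) + y * s * (s * x)) := by
      rw [show y * s * (s * x) = y * (s * s) * x by noncomm_ring, hc]
      noncomm_ring
    rw [e, mul_sub, sub_mul, h₁, h₂]
  refine d.continuous_of_seq_closed_graph fun u x y hu hdu => ?_
  have hs : IsSeparating d (y - d x) :=
    ⟨fun n => u n - x, by simpa using hu.sub_const x, by simpa using hdu.sub_const (d x)⟩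
  exact sub_eq_zero.mp
    (eq_zero_of_forall_mul_sq_eq_zero hsp fun a => hnil (hs.mul_left hleib a))

/-- A continuous commutativity preserving linear map on a zLpd Banach algebra satisfies the
image of the identity `[xy, z] + [yz, x] + [zx, y] = 0`. -/
theorem cyclic_commutator_sum_eq_zero (hzlpd : IsZeroLieProductDetermined A) (D : A →L[ℂ] A)
    (hcomm : ∀ x y : A, x * y - y * x = 0 → D x * D y - D y * D x = 0) (x y z : A) :
    (D (x * y) * D z - D z * D (x * y)) + (D (y * z) * D x - D x * D (y * z))
      + (D (z * x) * D y - D y * D (z * x)) = 0 := by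
  refine (SeparatingDual.eq_zero_iff_forall_dual_eq_zero (R := ℂ) _).mpr fun f => ?_
  let B : A →L[ℂ] A →L[ℂ] A := (ContinuousLinearMap.mul ℂ A).bilinearComp D D
  obtain ⟨ω, hω⟩ := hzlpd ((ContinuousLinearMap.compL ℂ A A ℂ f).comp (B - B.flip))
    (fun a b hab => by simpa [B] using congrArg f (hcomm a b hab))
  have hω' (a b : A) : f (D a * D b - D b * D a) = ω (a * b - b * a) := by
    rw [← hω]
    simp [B]
  rw [map_add, map_add, hω', hω', hω', ← map_add, ← map_add, ← map_zero ω]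
  congr 1
  noncomm_ring

end Continuity

/-- Let `A` be a semiprimitive, zero Lie product determined complex
Banach algebra, embedded via an injective ring homomorphism `ι` into a unital ring `Q`
so that `A` (i.e. the range of `ι`) is a `3`-free subset of `Q`, and let `d` be a
nonzero derivation of `A`.  Then there are `x y : A` with `[x,y] = 0` and
`[d x, d y] ≠ 0`. -/
theorem derivation_not_commutativity_preserving
    (A Q : Type*) [NormedRing A] [NormedAlgebra ℂ A] [CompleteSpace A] [Ring Q]
    (hsp : (⊥ : Ideal A).jacobson = ⊥)
    (hzlpd : IsZeroLieProductDetermined A)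
    (ι : A →+* Q) (hι : Function.Injective ι)
    (hfree : IsDFreeSubset (Set.range ι) 3)
    (d : A →ₗ[ℂ] A) (hleib : ∀ x y : A, d (x * y) = d x * y + x * d y)
    (hd : d ≠ 0) :
    ∃ x y : A, x * y - y * x = 0 ∧ d x * d y - d y * d x ≠ 0 := by
  by_contra! hcon
  have hsq (x : A) : x * (d x * d x) = d x * d x * x := by
    have h := hcon x (x * x) (by noncomm_ring)
    rw [hleib] at h
    linear_combination (norm := noncomm_ring) -h
  have hcont : Continuous d := continuous_of_commute_sq hsp hι hfree hleib hsq
  have hcyc (x y z : A) : x * (d y * d z) + y * (d z * d x) + z * (d x * d y)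
      = d y * d z * x + d z * d x * y + d x * d y * z := by
    have h := cyclic_commutator_sum_eq_zero hzlpd ⟨d, hcont⟩ hcon x y z
    simp only [ContinuousLinearMap.coe_mk', hleib] at h
    linear_combination (norm := noncomm_ring) h
  refine hd (LinearMap.ext fun x => ?_)
  refine derivation_eq_zero_of_commuting hι hfree d.toAddMonoidHom hleib (fun y => ?_) x
  exact commute_of_forall_commute_mul_mul hsp
    (commute_derivation_mul_mul_derivation hι hfree d.toAddMonoidHom hleib hcyc y)
end

section
/- Let A and B be unital complex Banach algebras. Assume that A is semiprime and zero Lie product determined, and that both A and B are 3-free (as subsets of themselves). If θ : A → B is a bijective continuous linear map that preserves commutativity (i.e., [x,y] = 0 implies [θ(x),θ(y)] = 0), then one of the following holds: (a) A contains an ideal J with J ⊄ Z(A) such that θ(J) ⊆ Z(B); or (b) there exist an invertible element λ ∈ Z(B), a continuous linear map τ : A → Z(B), and a continuous bijective linear map σ : A → B that is the direct sum of an isomorphism and an antiisomorphism, such that θ(x) = λσ(x) + τ(x) for all x ∈ A (in which case θ preserves commutativity in both directions). -/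
/-- A ring is *d-free* if it is a `d`-free subset of itself. -/
def IsDFree (Q : Type*) [Ring Q] (d : ℕ) : Prop :=
  IsDFreeSubset (Set.univ : Set Q) d

section FunctionalIdentities

variable {R : Type*} [Ring R]

theorem IsDFree.exists_standard_two (h : IsDFree R 3) (E₁ E₂ F₁ F₂ : R → R)
    (hEF : ∀ x y, E₁ y * x + E₂ x * y + (x * F₁ y + y * F₂ x) ∈ Subring.center R) :
    ∃ (p q : R) (l₁ l₂ : R → Subring.center R),
      (∀ y, E₁ y = y * p + l₁ y) ∧ (∀ x, E₂ x = x * q + l₂ x) ∧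
      (∀ y, F₁ y = -(q * y) - l₁ y) ∧ (∀ x, F₂ x = -(p * x) - l₂ x) := by
  obtain ⟨p, l, hp, hl, hlc, -, hE, hF⟩ := (h 2 (by norm_num) Finset.univ Finset.univ
    ![fun x => E₁ (x 1), fun x => E₂ (x 0)] ![fun x => F₁ (x 1), fun x => F₂ (x 0)]
    (by
      intro i _ x y hxy
      fin_cases i
      · simp [hxy 1 (by decide)]
      · simp [hxy 0 (by decide)])
    (by
      intro i _ x y hxy
      fin_cases i
      · simp [hxy 1 (by decide)]
      · simp [hxy 0 (by decide)])).2 (by simp)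
    (by
      intro x _
      rw [Fin.sum_univ_two, Fin.sum_univ_two]
      exact hEF (x 0) (x 1))
  have h0 : (Finset.univ : Finset (Fin 2)).erase 0 = {1} := by decide
  have h1 : (Finset.univ : Finset (Fin 2)).erase 1 = {0} := by decide
  have hp01 : ∀ x, p 0 1 x = p 0 1 0 := fun x =>
    hp 0 (by simp) 1 (by simp) (by decide) _ _ (by intro k; fin_cases k <;> simp)
  have hp10 : ∀ x, p 1 0 x = p 1 0 0 := fun x =>
    hp 1 (by simp) 0 (by simp) (by decide) _ _ (by intro k; fin_cases k <;> simp)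
  have hl0 : ∀ x y, l 0 ![x, y] = l 0 ![0, y] := fun x y =>
    hl 0 (by simp) _ _ (by intro k; fin_cases k <;> simp)
  have hl1 : ∀ x y, l 1 ![x, y] = l 1 ![x, 0] := fun x y =>
    hl 1 (by simp) _ _ (by intro k; fin_cases k <;> simp)
  refine ⟨p 0 1 0, p 1 0 0, fun y => ⟨l 0 ![0, y], hlc _ _⟩, fun x => ⟨l 1 ![x, 0], hlc _ _⟩,
    fun y => ?_, fun x => ?_, fun y => ?_, fun x => ?_⟩
  · simpa [h0, hp01] using hE 0 (by simp) ![0, y] (by simp)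
  · simpa [h1, hp10] using hE 1 (by simp) ![x, 0] (by simp)
  · simpa [h0, hp10] using hF 0 (by simp) ![0, y] (by simp)
  · simpa [h1, hp01] using hF 1 (by simp) ![x, 0] (by simp)

theorem IsDFree.mem_center_of_mul_sub_mul (h : IsDFree R 3) {c c' : R}
    (hc : ∀ x, c * x - x * c' ∈ Subring.center R) : c ∈ Subring.center R := by
  obtain ⟨p, q, l₁, l₂, h1, -⟩ := h.exists_standard_two (fun _ => c) 0 (fun _ => -c') 0
    (fun x y => by simpa [sub_eq_add_neg] using hc x)
  have := h1 0
  simp only [zero_mul, zero_add] at this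
  exact this ▸ (l₁ 0).2

theorem IsDFree.eq_zero_of_mul_mem_center (h : IsDFree R 3) {c : R}
    (hc : ∀ x, c * x ∈ Subring.center R) : c = 0 := by
  obtain ⟨p, q, l₁, l₂, h1, -, h3, -⟩ := h.exists_standard_two (fun _ => c) 0 0 0
    (fun x y => by simpa using hc x)
  have h4 := h1 0
  have h5 := h3 0
  simp only [zero_mul, zero_add, mul_zero, Pi.zero_apply, neg_zero, zero_sub] at h4 h5
  rw [h4, ← neg_eq_zero, ← h5]

theorem IsDFree.eq_zero_of_mul_add_mul (h : IsDFree R 3) {E₁ E₂ : R → R}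
    (hE : ∀ x y, E₁ y * x + E₂ x * y ∈ Subring.center R) :
    (∀ y, E₁ y = 0) ∧ ∀ x, E₂ x = 0 := by
  obtain ⟨p, q, l₁, l₂, h1, h2, h3, h4⟩ := h.exists_standard_two E₁ E₂ 0 0
    (fun x y => by simpa using hE x y)
  simp only [Pi.zero_apply] at h3 h4
  have hq : q = 0 := h.eq_zero_of_mul_mem_center fun y => by
    have : q * y = -l₁ y := by linear_combination (norm := noncomm_ring) h3 y
    rw [this]; exact neg_mem (l₁ y).2
  have hp : p = 0 := h.eq_zero_of_mul_mem_center fun y => by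
    have : p * y = -l₂ y := by linear_combination (norm := noncomm_ring) h4 y
    rw [this]; exact neg_mem (l₂ y).2
  subst hp hq
  simp only [zero_mul, neg_zero, zero_sub, mul_zero, zero_add] at *
  exact ⟨fun y => by rw [h1, ← neg_eq_zero, ← h3 y], fun x => by rw [h2, ← neg_eq_zero, ← h4 x]⟩

theorem IsDFree.eq_zero_of_mul_add_mul' (h : IsDFree R 3) {F₁ F₂ : R → R}
    (hF : ∀ x y, x * F₁ y + y * F₂ x ∈ Subring.center R) :
    (∀ y, F₁ y = 0) ∧ ∀ x, F₂ x = 0 := by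
  obtain ⟨p, q, l₁, l₂, h1, h2, h3, h4⟩ := h.exists_standard_two 0 0 F₁ F₂
    (fun x y => by simpa using hF x y)
  simp only [Pi.zero_apply] at h1 h2
  have key : ∀ (r : R) (l : R → Subring.center R), (∀ y, 0 = y * r + l y) →
      r = 0 ∧ ∀ y, (l y : R) = 0 := by
    intro r l hl
    have hm : ∀ y, y * r ∈ Subring.center R := fun y => by
      rw [eq_neg_of_add_eq_zero_left (hl y).symm]; exact neg_mem (l y).2
    have hr : r ∈ Subring.center R := by simpa using hm 1
    have hr0 : r = 0 := h.eq_zero_of_mul_mem_center fun y => by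
      rw [← Subring.mem_center_iff.1 hr y]; exact hm y
    exact ⟨hr0, fun y => by simpa [hr0] using (hl y).symm⟩
  obtain ⟨rfl, hl1⟩ := key p l₁ h1
  obtain ⟨rfl, hl2⟩ := key q l₂ h2
  exact ⟨fun y => by simp [h3, hl1], fun x => by simp [h4, hl2]⟩

theorem IsDFree.exists_standard_three (h : IsDFree R 3) (g : R → R → R)
    (hg : ∀ u v w, (g u v * w - w * g u v) + (g v w * u - u * g v w)
      + (g w u * v - v * g w u) = 0) :
    ∃ (p01 p02 p10 p12 p20 p21 : R → R) (l₀ l₁ l₂ : R → R → Subring.center R), ∀ u v,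
      g u v = u * p01 v + v * p02 u + l₀ u v ∧
      g u v = p10 v * u + p20 u * v + l₀ u v ∧
      g u v = v * p10 u + u * p12 v + l₁ u v ∧
      g u v = u * p20 v + v * p21 u + l₂ u v := by
  obtain ⟨p, l, hp, hl, hlc, -, hE, hF⟩ := (h 3 (by norm_num) Finset.univ Finset.univ
    ![fun x => g (x 1) (x 2), fun x => g (x 2) (x 0), fun x => g (x 0) (x 1)]
    ![fun x => -g (x 1) (x 2), fun x => -g (x 2) (x 0), fun x => -g (x 0) (x 1)]
    (by
      intro i _ x y hxy
      fin_cases i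
      · simp [hxy 1 (by decide), hxy 2 (by decide)]
      · simp [hxy 0 (by decide), hxy 2 (by decide)]
      · simp [hxy 0 (by decide), hxy 1 (by decide)])
    (by
      intro i _ x y hxy
      fin_cases i
      · simp [hxy 1 (by decide), hxy 2 (by decide)]
      · simp [hxy 0 (by decide), hxy 2 (by decide)]
      · simp [hxy 0 (by decide), hxy 1 (by decide)])).1 (by simp)
    (by
      intro x _
      rw [← hg (x 0) (x 1) (x 2)]
      simp [Fin.sum_univ_three]
      abel)
  have h0 : (Finset.univ : Finset (Fin 3)).erase 0 = {1, 2} := by decide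
  have h1 : (Finset.univ : Finset (Fin 3)).erase 1 = {0, 2} := by decide
  have h2 : (Finset.univ : Finset (Fin 3)).erase 2 = {0, 1} := by decide
  have hpij : ∀ i j k : Fin 3, i ≠ j → (∀ r, r ≠ i → r ≠ j → r = k) →
      ∀ x : Fin 3 → R, p i j x = p i j (fun _ => x k) := fun i j k hij hk x =>
    hp i (by simp) j (by simp) hij _ _ (by
      intro r hri hrj
      rw [hk r hri hrj])
  have hp01 := hpij 0 1 2 (by decide) (by decide)
  have hp02 := hpij 0 2 1 (by decide) (by decide)
  have hp10 := hpij 1 0 2 (by decide) (by decide)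
  have hp12 := hpij 1 2 0 (by decide) (by decide)
  have hp20 := hpij 2 0 1 (by decide) (by decide)
  have hp21 := hpij 2 1 0 (by decide) (by decide)
  refine ⟨fun t => p 0 1 fun _ => t, fun t => p 0 2 fun _ => t, fun t => p 1 0 fun _ => t,
    fun t => p 1 2 fun _ => t, fun t => p 2 0 fun _ => t, fun t => p 2 1 fun _ => t,
    fun u v => ⟨l 0 ![0, u, v], hlc _ _⟩, fun u v => ⟨l 1 ![v, 0, u], hlc _ _⟩,
    fun u v => ⟨l 2 ![u, v, 0], hlc _ _⟩, fun u v => ⟨?_, ?_, ?_, ?_⟩⟩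
  · have := hE 0 (by simp) ![0, u, v] (by simp)
    rw [h0, Finset.sum_pair (by decide), hp01, hp02] at this
    simpa using this
  · have := hF 0 (by simp) ![0, u, v] (by simp)
    rw [h0, Finset.sum_pair (by decide), hp10, hp20, ← neg_add', eq_comm, neg_eq_iff_eq_neg] at this
    simpa using this.symm
  · have := hE 1 (by simp) ![v, 0, u] (by simp)
    rw [h1, Finset.sum_pair (by decide), hp10, hp12] at this
    simpa using this
  · have := hE 2 (by simp) ![u, v, 0] (by simp)
    rw [h2, Finset.sum_pair (by decide), hp20, hp21] at this
    simpa using this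

/-- A map satisfying the cyclic commutator identity has the form
`a u v + b v u + m(v) u + m(u) v + n(u,v)` with central coefficients. -/
theorem IsDFree.exists_quasi_polynomial (h : IsDFree R 3) (g : R → R → R)
    (hg : ∀ u v w, (g u v * w - w * g u v) + (g v w * u - u * g v w)
      + (g w u * v - v * g w u) = 0) :
    ∃ (a b : Subring.center R) (m : R → Subring.center R) (n : R → R → Subring.center R),
      ∀ u v, g u v = a • (u * v) + b • (v * u) + m v • u + m u • v + n u v • (1 : R) := by
  obtain ⟨p01, p02, p10, p12, p20, p21, l₀, l₁, l₂, H⟩ := h.exists_standard_three g hg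
  have e1 := h.eq_zero_of_mul_add_mul' (F₁ := fun v => p01 v - p12 v)
    (F₂ := fun u => p02 u - p10 u) fun u v => by
      have : u * (p01 v - p12 v) + v * (p02 u - p10 u) = (l₁ u v - l₀ u v : R) := by
        linear_combination (norm := noncomm_ring) (H u v).2.2.1 - (H u v).1
      rw [this]; exact sub_mem (l₁ u v).2 (l₀ u v).2
  have e2 := h.eq_zero_of_mul_add_mul' (F₁ := fun v => p01 v - p20 v)
    (F₂ := fun u => p02 u - p21 u) fun u v => by
      have : u * (p01 v - p20 v) + v * (p02 u - p21 u) = (l₂ u v - l₀ u v : R) := by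
        linear_combination (norm := noncomm_ring) (H u v).2.2.2 - (H u v).1
      rw [this]; exact sub_mem (l₂ u v).2 (l₀ u v).2
  have hP : p20 = p01 := funext fun v => (sub_eq_zero.1 (e2.1 v)).symm
  have hQ : p10 = p02 := funext fun v => (sub_eq_zero.1 (e1.2 v)).symm
  subst hP hQ
  obtain ⟨p, q, m₁, m₂, k1, k2, k3, k4⟩ := h.exists_standard_two (fun v => -p10 v)
    (fun u => -p20 u) p20 p10 fun u v => by
      have : -p10 v * u + -p20 u * v + (u * p20 v + v * p10 u) = 0 := by
        linear_combination (norm := noncomm_ring) (H u v).2.1 - (H u v).1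
      rw [this]; exact zero_mem _
  have hq : q ∈ Subring.center R := h.mem_center_of_mul_sub_mul fun x => by
    have : q * x - x * q = (m₂ x - m₁ x : R) := by
      linear_combination (norm := noncomm_ring) k3 x + k2 x
    rw [this]; exact sub_mem (m₂ x).2 (m₁ x).2
  have hp : p ∈ Subring.center R := h.mem_center_of_mul_sub_mul fun x => by
    have : p * x - x * p = (m₁ x - m₂ x : R) := by
      linear_combination (norm := noncomm_ring) k4 x + k1 x
    rw [this]; exact sub_mem (m₁ x).2 (m₂ x).2
  have hm : ∀ x, (m₂ x : R) = m₁ x := fun x => by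
    have := Subring.mem_center_iff.1 hq x
    linear_combination (norm := noncomm_ring) -k3 x - k2 x - this
  refine ⟨-⟨q, hq⟩, -⟨p, hp⟩, fun x => -m₁ x, l₀, fun u v => ?_⟩
  have cq := Subring.mem_center_iff.1 hq u
  have cp := Subring.mem_center_iff.1 hp v
  have c1 := Subring.mem_center_iff.1 (m₁ v).2 u
  have c2 := Subring.mem_center_iff.1 (m₁ u).2 v
  rw [(H u v).1, k3, k4, hm]
  simp only [Subring.smul_def, smul_eq_mul, NegMemClass.coe_neg, mul_sub, mul_neg, ← mul_assoc, cq, cp, c1, c2,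
    neg_mul, mul_one]
  abel

end FunctionalIdentities

section QuasiHom

variable {A B : Type*} [Ring A] [Ring B]

theorem smul_one_mem_center (c : Subring.center B) : c • (1 : B) ∈ Subring.center B := by
  rw [Subring.smul_def, smul_eq_mul, mul_one]
  exact c.2

theorem mem_center_of_eq_smul_one {x : B} {c : Subring.center B} (h : x = c • (1 : B)) :
    x ∈ Subring.center B :=
  h ▸ smul_one_mem_center c

theorem IsDFree.smul_eq_zero (h : IsDFree B 3) {c : Subring.center B}
    (hc : ∀ x : B, c • x ∈ Subring.center B) : c = 0 :=
  Subtype.ext (h.eq_zero_of_mul_mem_center hc)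

/-- The map `θ` is multiplicative up to the central coefficients `a`, `b`, `μ`, `ν`. -/
def IsQuasiHom (θ : A ≃+ B) (a b : Subring.center B) (μ : A → Subring.center B)
    (ν : A → A → Subring.center B) : Prop :=
  ∀ x y, θ (x * y) = a • (θ x * θ y) + b • (θ y * θ x) + μ y • θ x + μ x • θ y + ν x y • (1 : B)

namespace IsQuasiHom

variable {θ : A ≃+ B} {a b : Subring.center B} {μ : A → Subring.center B}
  {ν : A → A → Subring.center B}

theorem associativity (H : IsQuasiHom θ a b μ ν) (x y z : A) :
    (a * b) • (θ y * θ x * θ z + θ z * (θ x * θ y) - θ x * (θ z * θ y) - θ y * θ z * θ x)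
      + ((a + b) * ν x y + μ (x * y) - μ x * μ y) • θ z
      - ((a + b) * ν y z + μ (y * z) - μ y * μ z) • θ x
      = (μ x * ν y z + ν x (y * z) - μ z * ν x y - ν (x * y) z) • (1 : B) := by
  have h : θ (x * y * z) = θ (x * (y * z)) := by rw [mul_assoc]
  rw [H (x * y) z, H x (y * z), H x y, H y z] at h
  simp only [mul_add, add_mul, smul_add, smul_mul_assoc, mul_smul_comm, mul_assoc, mul_one,
    one_mul] at h ⊢
  linear_combination (norm := module) h

theorem mul_eq_zero (H : IsQuasiHom θ a b μ ν) (hB : IsDFree B 3) : a * b = 0 := by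
  refine hB.smul_eq_zero fun Y => ?_
  obtain ⟨p, q, l₁, l₂, -, h2, -, -⟩ := hB.exists_standard_two
    (fun Z => -((a * b) • (Y * Z)) - ((a + b) * ν (θ.symm Y) (θ.symm Z)
      + μ (θ.symm Y * θ.symm Z) - μ (θ.symm Y) * μ (θ.symm Z)) • (1 : B))
    (fun X => (a * b) • (Y * X) + ((a + b) * ν (θ.symm X) (θ.symm Y)
      + μ (θ.symm X * θ.symm Y) - μ (θ.symm X) * μ (θ.symm Y)) • (1 : B))
    (fun Z => -((a * b) • (Z * Y))) (fun X => (a * b) • (X * Y)) (fun X Z => by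
      have h := H.associativity (θ.symm X) (θ.symm Y) (θ.symm Z)
      simp only [AddEquiv.apply_symm_apply] at h
      refine mem_center_of_eq_smul_one (Eq.trans ?_ h)
      simp only [smul_sub, smul_add, add_mul, sub_mul, smul_mul_assoc, neg_mul, mul_neg,
        mul_smul_comm, one_mul, mul_assoc]
      module)
  refine hB.mem_center_of_mul_sub_mul (c' := q) fun X => ?_
  have : (a * b) • Y * X - X * q = l₂ X - ((a + b) * ν (θ.symm X) (θ.symm Y)
      + μ (θ.symm X * θ.symm Y) - μ (θ.symm X) * μ (θ.symm Y)) • (1 : B) := by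
    rw [smul_mul_assoc]
    linear_combination (norm := module) h2 X
  rw [this]
  exact sub_mem (l₂ X).2 (smul_one_mem_center _)

theorem coeff_relation (H : IsQuasiHom θ a b μ ν) (hB : IsDFree B 3) (x y : A) :
    (a + b) * ν x y + μ (x * y) = μ x * μ y := by
  have h := (hB.eq_zero_of_mul_add_mul
    (E₁ := fun Z => -((a + b) * ν y (θ.symm Z) + μ (y * θ.symm Z) - μ y * μ (θ.symm Z)) • (1 : B))
    (E₂ := fun X => ((a + b) * ν (θ.symm X) y + μ (θ.symm X * y) - μ (θ.symm X) * μ y) • (1 : B))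
    fun X Z => by
      have h := H.associativity (θ.symm X) y (θ.symm Z)
      rw [H.mul_eq_zero hB, zero_smul] at h
      simp only [AddEquiv.apply_symm_apply] at h
      refine mem_center_of_eq_smul_one (Eq.trans ?_ h)
      simp only [smul_mul_assoc, one_mul]
      module).2 (θ x)
  simp only [AddEquiv.symm_apply_apply, Subring.smul_def, smul_eq_mul, mul_one] at h
  exact sub_eq_zero.1 (Subtype.ext h)

theorem map_add (H : IsQuasiHom θ a b μ ν) (hB : IsDFree B 3) (x y : A) :
    μ (x + y) = μ x + μ y := by
  refine sub_eq_zero.1 (hB.smul_eq_zero fun Z => ?_)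
  obtain ⟨z, rfl⟩ := θ.surjective Z
  refine mem_center_of_eq_smul_one (c := ν x z + ν y z - ν (x + y) z) ?_
  have h := congrArg θ (add_mul x y z)
  rw [_root_.map_add, H, H, H, _root_.map_add] at h
  simp only [mul_add, add_mul, smul_add] at h
  linear_combination (norm := module) h

/-- The Jordan homomorphism attached to `θ`. -/
def jordanHom (H : IsQuasiHom θ a b μ ν) (hB : IsDFree B 3) : A →+ B where
  toFun x := (a + b) • θ x + μ x • (1 : B)
  map_zero' := by
    have : μ 0 = 0 := by simpa using H.map_add hB 0 0
    simp [this]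
  map_add' x y := by
    rw [_root_.map_add, H.map_add hB]
    module

variable (H : IsQuasiHom θ a b μ ν) (hB : IsDFree B 3)

theorem jordanHom_apply (x : A) : H.jordanHom hB x = (a + b) • θ x + μ x • (1 : B) := rfl

theorem smul_mul_eq_zero (H : IsQuasiHom θ a b μ ν) (hB : IsDFree B 3) (x : B) :
    (a * b) • x = 0 := by
  rw [H.mul_eq_zero hB, zero_smul]

theorem jordanHom_mul (x y : A) :
    H.jordanHom hB (x * y) = (a * a) • (θ x * θ y) + (b * b) • (θ y * θ x)
      + ((a + b) * μ y) • θ x + ((a + b) * μ x) • θ y + (μ x * μ y) • (1 : B) := by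
  rw [jordanHom_apply, ← H.coeff_relation hB, H]
  linear_combination (norm := module)
    H.smul_mul_eq_zero hB (θ x * θ y) + H.smul_mul_eq_zero hB (θ y * θ x)

theorem jordanHom_commutator (x y : A) :
    H.jordanHom hB (x * y - y * x) = (a * a - b * b) • (θ x * θ y - θ y * θ x) := by
  rw [map_sub, jordanHom_mul, jordanHom_mul]
  module

theorem smul_jordanHom_mul (x y : A) :
    (a + b) • H.jordanHom hB (x * y) = a • (H.jordanHom hB x * H.jordanHom hB y)
      + b • (H.jordanHom hB y * H.jordanHom hB x) := by
  rw [jordanHom_mul, jordanHom_apply, jordanHom_apply]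
  simp only [mul_add, add_mul, smul_add, smul_mul_assoc, mul_smul_comm, mul_one, one_mul]
  linear_combination (norm := module) -(a + b) • H.smul_mul_eq_zero hB (θ x * θ y)
    - (a + b) • H.smul_mul_eq_zero hB (θ y * θ x)

section Kernel

variable {x : A}

theorem smul_apply_of_ker (hx : H.jordanHom hB x = 0) : (a + b) • θ x = -μ x • (1 : B) := by
  rw [jordanHom_apply] at hx
  linear_combination (norm := module) hx

theorem smul_apply_mul_of_ker (hx : H.jordanHom hB x = 0) (Y : B) :
    (a + b) • (θ x * Y) = -μ x • Y := by
  rw [← smul_mul_assoc, H.smul_apply_of_ker hB hx, smul_mul_assoc, one_mul]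

theorem smul_mul_apply_of_ker (hx : H.jordanHom hB x = 0) (Y : B) :
    (a + b) • (Y * θ x) = -μ x • Y := by
  rw [← mul_smul_comm, H.smul_apply_of_ker hB hx, mul_smul_comm, mul_one]

theorem apply_mul_of_ker (hx : H.jordanHom hB x = 0) (y : A) :
    θ (x * y) = a • (θ x * θ y - θ y * θ x) + μ y • θ x + ν x y • (1 : B) := by
  rw [H]
  linear_combination (norm := module) H.smul_mul_apply_of_ker hB hx (θ y)

theorem apply_mul_of_ker' (hx : H.jordanHom hB x = 0) (y : A) :
    θ (y * x) = a • (θ y * θ x - θ x * θ y) + μ y • θ x + ν y x • (1 : B) := by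
  rw [H]
  linear_combination (norm := module) H.smul_apply_mul_of_ker hB hx (θ y)

theorem jordanHom_mul_of_ker (hx : H.jordanHom hB x = 0) (y : A) :
    H.jordanHom hB (x * y) = 0 := by
  rw [jordanHom_mul]
  linear_combination (norm := module) a • H.smul_apply_mul_of_ker hB hx (θ y)
    + b • H.smul_mul_apply_of_ker hB hx (θ y) + μ y • H.smul_apply_of_ker hB hx
    - H.smul_mul_eq_zero hB (θ x * θ y) - H.smul_mul_eq_zero hB (θ y * θ x)

theorem jordanHom_mul_of_ker' (hx : H.jordanHom hB x = 0) (y : A) :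
    H.jordanHom hB (y * x) = 0 := by
  rw [jordanHom_mul]
  linear_combination (norm := module) a • H.smul_mul_apply_of_ker hB hx (θ y)
    + b • H.smul_apply_mul_of_ker hB hx (θ y) + μ y • H.smul_apply_of_ker hB hx
    - H.smul_mul_eq_zero hB (θ x * θ y) - H.smul_mul_eq_zero hB (θ y * θ x)

theorem apply_mul_commutator_mem_center (hx : H.jordanHom hB x = 0) {z : A}
    (hz : H.jordanHom hB z = 0) (y : A) : θ (z * (x * y - y * x)) ∈ Subring.center B := by
  have hw : H.jordanHom hB (x * y - y * x) = 0 := by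
    rw [map_sub, H.jordanHom_mul_of_ker hB hx, H.jordanHom_mul_of_ker' hB hx, sub_zero]
  have hθw : θ (x * y - y * x)
      = (2 * a) • (θ x * θ y - θ y * θ x) + (ν x y - ν y x) • (1 : B) := by
    rw [map_sub, H.apply_mul_of_ker hB hx, H.apply_mul_of_ker' hB hx]
    module
  have hD : (a + b) • (θ x * θ y - θ y * θ x) = 0 := by
    linear_combination (norm := module) H.smul_apply_mul_of_ker hB hx (θ y)
      - H.smul_mul_apply_of_ker hB hx (θ y)
  rw [H.apply_mul_of_ker' hB hw, hθw]
  generalize θ x * θ y - θ y * θ x = D at hD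
  have haD : (a * a) • D = 0 := by
    linear_combination (norm := module) a • hD - H.smul_mul_eq_zero hB D
  have h1 : (a * a) • (θ z * D) = 0 := by rw [← mul_smul_comm, haD, mul_zero]
  have h2 : (a * a) • (D * θ z) = 0 := by rw [← smul_mul_assoc, haD, zero_mul]
  have h3 : μ z • D = 0 := by
    rw [← neg_eq_zero, ← neg_smul, ← H.smul_apply_mul_of_ker hB hz, ← mul_smul_comm, hD, mul_zero]
  refine mem_center_of_eq_smul_one
    (c := μ z * (ν x y - ν y x) + ν z (x * y - y * x)) ?_
  simp only [mul_add, add_mul, smul_mul_assoc, mul_smul_comm, mul_one, one_mul]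
  linear_combination (norm := module) (2 : Subring.center B) • h1 - (2 : Subring.center B) • h2
    + (2 * a) • h3

theorem jordanHom_injective (hA : IsDFree A 3)
    (hsemi : ∀ I : TwoSidedIdeal A, (∀ x ∈ I, ∀ y ∈ I, x * y = 0) → I = ⊥)
    (hcen : ∀ J : TwoSidedIdeal A, (∀ x ∈ J, θ x ∈ Subring.center B) →
      (J : Set A) ⊆ Set.center A) : Function.Injective (H.jordanHom hB) := by
  let L : TwoSidedIdeal A := TwoSidedIdeal.mk'
    {x | H.jordanHom hB x = 0 ∧ θ x ∈ Subring.center B}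
    ⟨map_zero _, by rw [map_zero]; exact zero_mem _⟩
    (fun {x y} hx hy => ⟨by rw [_root_.map_add, hx.1, hy.1, add_zero],
      by rw [_root_.map_add]; exact add_mem hx.2 hy.2⟩)
    (fun {x} hx => ⟨by rw [map_neg, hx.1, neg_zero], by rw [map_neg]; exact neg_mem hx.2⟩)
    (fun {y x} hx => ⟨H.jordanHom_mul_of_ker' hB hx.1 y, by
      rw [H.apply_mul_of_ker' hB hx.1, Subring.mem_center_iff.1 hx.2, sub_self, smul_zero, zero_add]
      exact add_mem (mul_mem (μ y).2 hx.2) (smul_one_mem_center _)⟩)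
    (fun {x y} hx => ⟨H.jordanHom_mul_of_ker hB hx.1 y, by
      rw [H.apply_mul_of_ker hB hx.1, Subring.mem_center_iff.1 hx.2, sub_self, smul_zero, zero_add]
      exact add_mem (mul_mem (μ y).2 hx.2) (smul_one_mem_center _)⟩)
  have hL : ∀ x, H.jordanHom hB x = 0 → θ x ∈ Subring.center B → x = 0 := fun x hx hθ =>
    hA.eq_zero_of_mul_mem_center fun y => hcen L (fun x hx => (TwoSidedIdeal.mem_mk' .. |>.1 hx).2)
      (L.mul_mem_right x y (TwoSidedIdeal.mem_mk' .. |>.2 ⟨hx, hθ⟩))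
  let N : TwoSidedIdeal A := TwoSidedIdeal.mk'
    {x | H.jordanHom hB x = 0 ∧ ∀ z, H.jordanHom hB z = 0 → z * x = 0}
    ⟨map_zero _, fun z _ => mul_zero z⟩
    (fun {x y} hx hy => ⟨by rw [_root_.map_add, hx.1, hy.1, add_zero],
      fun z hz => by rw [mul_add, hx.2 z hz, hy.2 z hz, add_zero]⟩)
    (fun {x} hx => ⟨by rw [map_neg, hx.1, neg_zero],
      fun z hz => by rw [mul_neg, hx.2 z hz, neg_zero]⟩)
    (fun {y x} hx => ⟨H.jordanHom_mul_of_ker' hB hx.1 y, fun z hz => by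
      rw [← mul_assoc, hx.2 _ (H.jordanHom_mul_of_ker hB hz y)]⟩)
    (fun {x y} hx => ⟨H.jordanHom_mul_of_ker hB hx.1 y, fun z hz => by
      rw [← mul_assoc, hx.2 z hz, zero_mul]⟩)
  have hN : N = ⊥ := hsemi N fun x hx y hy =>
    (TwoSidedIdeal.mem_mk' .. |>.1 hy).2 x (TwoSidedIdeal.mem_mk' .. |>.1 hx).1
  have hker : ∀ x, H.jordanHom hB x = 0 → x ∈ Subring.center A := fun x hx => by
    refine Subring.mem_center_iff.2 fun y => ?_
    have hw : H.jordanHom hB (x * y - y * x) = 0 := by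
      rw [map_sub, H.jordanHom_mul_of_ker hB hx, H.jordanHom_mul_of_ker' hB hx, sub_zero]
    have hmem : x * y - y * x ∈ N := TwoSidedIdeal.mem_mk' .. |>.2 ⟨hw, fun z hz =>
      hL _ (H.jordanHom_mul_of_ker' hB hw z) (H.apply_mul_commutator_mem_center hB hx hz y)⟩
    rw [hN, TwoSidedIdeal.mem_bot] at hmem
    exact (sub_eq_zero.1 hmem).symm
  exact (injective_iff_map_eq_zero _).2 fun x hx =>
    hA.eq_zero_of_mul_mem_center fun y => hker _ (H.jordanHom_mul_of_ker hB hx y)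

end Kernel

section Inverse

variable {H hB}

theorem mem_center_of_apply_mem_center (hinj : Function.Injective (H.jordanHom hB))
    {x : A} (hx : θ x ∈ Subring.center B) :
    x ∈ Subring.center A := by
  refine Subring.mem_center_iff.2 fun y => (sub_eq_zero.1 (hinj ?_)).symm
  rw [jordanHom_commutator, map_zero, Subring.mem_center_iff.1 hx, sub_self, smul_zero]

theorem symm_cyclic (hinj : Function.Injective (H.jordanHom hB)) (u v w : A) :
    (θ.symm (θ u * θ v) * w - w * θ.symm (θ u * θ v))
      + (θ.symm (θ v * θ w) * u - u * θ.symm (θ v * θ w))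
      + (θ.symm (θ w * θ u) * v - v * θ.symm (θ w * θ u)) = 0 := by
  apply hinj
  simp only [_root_.map_add, jordanHom_commutator, map_zero, AddEquiv.apply_symm_apply, mul_assoc]
  module

theorem exists_isQuasiHom_symm (hinj : Function.Injective (H.jordanHom hB))
    (hA : IsDFree A 3) :
    ∃ (c d : Subring.center A) (m : A → Subring.center A) (n : A → A → Subring.center A),
      ∀ x y, θ x * θ y
        = θ (c • (x * y) + d • (y * x) + m y • x + m x • y + n x y • (1 : A)) := by
  obtain ⟨c, d, m, n, h⟩ := hA.exists_quasi_polynomial (fun x y => θ.symm (θ x * θ y))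
    (symm_cyclic hinj)
  exact ⟨c, d, m, n, fun x y => by rw [← h, AddEquiv.apply_symm_apply]⟩

end Inverse

theorem jordanHom_mem_center
    (hcen : ∀ x ∈ Subring.center A, θ x ∈ Subring.center B)
    {c : A} (hc : c ∈ Subring.center A) :
    H.jordanHom hB c ∈ Subring.center B :=
  add_mem (mul_mem (a + b).2 (hcen c hc)) (smul_one_mem_center _)

theorem apply_center_mul
    (hcen : ∀ x ∈ Subring.center A, θ x ∈ Subring.center B)
    {c : A} (hc : c ∈ Subring.center A) (x : A) :
    θ (c * x) - H.jordanHom hB c * θ x ∈ Subring.center B := by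
  refine mem_center_of_eq_smul_one (c := μ x * ⟨θ c, hcen c hc⟩ + ν c x) ?_
  have h1 : μ x • θ c = (μ x * ⟨θ c, hcen c hc⟩) • (1 : B) := by
    simp [Subring.smul_def]
  rw [H, jordanHom_apply, Subring.mem_center_iff.1 (hcen c hc), h1]
  simp only [add_mul, smul_mul_assoc, one_mul]
  module

theorem isUnit_coeff
    (hcen : ∀ x ∈ Subring.center A, θ x ∈ Subring.center B)
    (hA : IsDFree A 3) (hinj : Function.Injective (H.jordanHom hB)) :
    IsUnit (a + b) := by
  obtain ⟨c, d, m, n, h⟩ := exists_isQuasiHom_symm hinj hA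
  let σ : Subring.center A → Subring.center B := fun t =>
    ⟨H.jordanHom hB t, H.jordanHom_mem_center hB hcen t.2⟩
  have hσ : ∀ (t : Subring.center A) (x : A), ∃ k : Subring.center B,
      θ (t • x) = σ t • θ x + k • (1 : B) := fun t x =>
    ⟨⟨_, H.apply_center_mul hB hcen t.2 x⟩, by simp [Subring.smul_def, σ]⟩
  have hpol := hB.eq_zero_of_mul_add_mul
    (E₁ := fun Y => -(σ c * b + σ d * a) • Y
      - ((σ c + σ d) * μ (θ.symm Y) + σ (m (θ.symm Y))) • (1 : B))
    (E₂ := fun X => (1 - σ c * a - σ d * b) • X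
      - ((σ c + σ d) * μ (θ.symm X) + σ (m (θ.symm X))) • (1 : B)) fun X Y => by
      obtain ⟨x, rfl⟩ := θ.surjective X
      obtain ⟨y, rfl⟩ := θ.surjective Y
      have hxy := h x y
      obtain ⟨k1, e1⟩ := hσ c (x * y)
      obtain ⟨k2, e2⟩ := hσ d (y * x)
      obtain ⟨k3, e3⟩ := hσ (m y) x
      obtain ⟨k4, e4⟩ := hσ (m x) y
      obtain ⟨k5, e5⟩ := hσ (n x y) 1
      have h1 : θ 1 ∈ Subring.center B := hcen 1 (one_mem _)
      have e6 : θ 1 = (⟨θ 1, h1⟩ : Subring.center B) • (1 : B) := by simp [Subring.smul_def]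
      rw [e6] at e5
      rw [_root_.map_add, _root_.map_add, _root_.map_add, _root_.map_add, e1, e2, e3, e4, e5,
        H x y, H y x] at hxy
      refine mem_center_of_eq_smul_one (c := σ c * ν x y + σ d * ν y x + k1 + k2 + k3 + k4 + k5
        + σ (n x y) * ⟨θ 1, h1⟩) ?_
      simp only [AddEquiv.symm_apply_apply, sub_mul, smul_mul_assoc, one_mul]
      linear_combination (norm := module) hxy
  have key : ∀ (k : Subring.center B) (f : B → Subring.center B),
      (∀ X : B, k • X - f X • (1 : B) = 0) → k = 0 := fun k f hk =>
    hB.smul_eq_zero fun X => mem_center_of_eq_smul_one (sub_eq_zero.1 (hk X))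
  have h1 := key _ _ hpol.1
  have h2 := key _ _ hpol.2
  exact IsUnit.of_mul_eq_one (σ c + σ d) (by linear_combination -h1 - h2)

theorem exists_jordanHom_eq_of_mem_center
    (hcen : ∀ x ∈ Subring.center A, θ x ∈ Subring.center B)
    (hA : IsDFree A 3)
    (hinj : Function.Injective (H.jordanHom hB)) {z : B} (hz : z ∈ Subring.center B) :
    ∃ c, H.jordanHom hB c = z := by
  obtain ⟨c, d, m, n, h⟩ := exists_isQuasiHom_symm hinj hA
  obtain ⟨t, rfl⟩ := θ.surjective z
  have ht := mem_center_of_apply_mem_center hinj hz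
  set s : Subring.center A := ⟨t, ht⟩ with hs
  refine ⟨((c + d) * s + m t : Subring.center A), sub_eq_zero.1
    (hB.eq_zero_of_mul_mem_center fun X => ?_)⟩
  obtain ⟨x, rfl⟩ := θ.surjective X
  have hx : c • (t * x) + d • (x * t) + m x • t + m t • x + n t x • (1 : A)
      = (((c + d) * s + m t : Subring.center A) : A) * x + (m x * s + n t x : Subring.center A) := by
    rw [Subring.mem_center_iff.1 ht x]
    simp only [Subring.smul_def, smul_eq_mul, hs, Subring.coe_add, Subring.coe_mul, add_mul,
      mul_one, mul_assoc]
    abel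
  have h1 := H.apply_center_mul hB hcen ((c + d) * s + m t).2 x
  rw [sub_mul, h t x, hx, _root_.map_add, sub_add_eq_sub_sub]
  refine sub_mem ?_ (hcen _ (Subtype.mem _))
  simpa using neg_mem h1

theorem jordanHom_surjective
    (hcen : ∀ x ∈ Subring.center A, θ x ∈ Subring.center B)
    (hA : IsDFree A 3)
    (hinj : Function.Injective (H.jordanHom hB)) : Function.Surjective (H.jordanHom hB) := by
  intro y
  obtain ⟨s, hs⟩ := H.isUnit_coeff hB hcen hA hinj
  obtain ⟨x, hx⟩ := θ.surjective ((↑s⁻¹ : Subring.center B) • y)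
  obtain ⟨c, hc⟩ := H.exists_jordanHom_eq_of_mem_center hB hcen hA hinj
    (smul_one_mem_center (μ x))
  refine ⟨x - c, ?_⟩
  rw [map_sub, hc, jordanHom_apply, add_sub_cancel_right, hx, ← hs, smul_smul, Units.mul_inv,
    one_smul]

end IsQuasiHom

end QuasiHom

section DirectSum

variable {A B : Type*} [Ring A] [Ring B]

/-- The two-sided ideal of elements annihilated by a central element. -/
def centralAnnihilator (k : Subring.center B) : TwoSidedIdeal B :=
  TwoSidedIdeal.mk' {y | k • y = 0} (smul_zero k)
    (fun {x y} (hx : k • x = 0) (hy : k • y = 0) => by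
      rw [Set.mem_ofPred_eq, smul_add, hx, hy, add_zero])
    (fun {x} (hx : k • x = 0) => by rw [Set.mem_ofPred_eq, smul_neg, hx, neg_zero])
    (fun {x y} (hy : k • y = 0) => by
      rw [Set.mem_ofPred_eq, ← mul_smul_comm, hy, mul_zero])
    (fun {x y} (hx : k • x = 0) => by
      rw [Set.mem_ofPred_eq, ← smul_mul_assoc, hx, zero_mul])

theorem mem_centralAnnihilator {k : Subring.center B} {y : B} :
    y ∈ centralAnnihilator k ↔ k • y = 0 :=
  TwoSidedIdeal.mem_mk' ..

/-- The preimage of `centralAnnihilator k` under a map which mixes the product and the opposite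
product. -/
def comapCentralAnnihilator (σ : A →+ B) {e f : Subring.center B}
    (hmul : ∀ x y, σ (x * y) = e • (σ x * σ y) + f • (σ y * σ x)) (k : Subring.center B) :
    TwoSidedIdeal A :=
  TwoSidedIdeal.mk' {x | σ x ∈ centralAnnihilator k} (by
      rw [Set.mem_ofPred_eq, map_zero]; exact zero_mem _)
    (fun {x y} hx hy => by rw [Set.mem_ofPred_eq, map_add]; exact add_mem hx hy)
    (fun {x} hx => by rw [Set.mem_ofPred_eq, map_neg]; exact neg_mem hx)
    (fun {x y} hy => by
      rw [Set.mem_ofPred_eq, hmul, Subring.smul_def, Subring.smul_def]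
      exact add_mem
        (TwoSidedIdeal.mul_mem_left _ _ _ (TwoSidedIdeal.mul_mem_left _ _ _ hy))
        (TwoSidedIdeal.mul_mem_left _ _ _ (TwoSidedIdeal.mul_mem_right _ _ _ hy)))
    (fun {x y} hx => by
      rw [Set.mem_ofPred_eq, hmul, Subring.smul_def, Subring.smul_def]
      exact add_mem
        (TwoSidedIdeal.mul_mem_left _ _ _ (TwoSidedIdeal.mul_mem_right _ _ _ hx))
        (TwoSidedIdeal.mul_mem_left _ _ _ (TwoSidedIdeal.mul_mem_left _ _ _ hx)))

theorem mem_comapCentralAnnihilator {σ : A →+ B} {e f : Subring.center B}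
    {hmul : ∀ x y, σ (x * y) = e • (σ x * σ y) + f • (σ y * σ x)} {k : Subring.center B} {x : A} :
    x ∈ comapCentralAnnihilator σ hmul k ↔ k • σ x = 0 :=
  (TwoSidedIdeal.mem_mk' ..).trans mem_centralAnnihilator

theorem image_comapCentralAnnihilator {σ : A →+ B} (hσ : Function.Bijective σ)
    {e f : Subring.center B} (hmul : ∀ x y, σ (x * y) = e • (σ x * σ y) + f • (σ y * σ x))
    (k : Subring.center B) :
    σ '' (comapCentralAnnihilator σ hmul k : Set A) = (centralAnnihilator k : Set B) := by
  ext y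
  constructor
  · rintro ⟨x, hx, rfl⟩
    exact mem_centralAnnihilator.2 (mem_comapCentralAnnihilator.1 hx)
  · intro hy
    obtain ⟨x, rfl⟩ := hσ.2 y
    exact ⟨x, mem_comapCentralAnnihilator.2 (mem_centralAnnihilator.1 hy), rfl⟩

theorem isCompl_comapCentralAnnihilator {σ : A →+ B} (hσ : Function.Bijective σ)
    {e f : Subring.center B} (hmul : ∀ x y, σ (x * y) = e • (σ x * σ y) + f • (σ y * σ x))
    (hadd : e + f = 1) (hef : e * f = 0) :
    IsCompl (comapCentralAnnihilator σ hmul f) (comapCentralAnnihilator σ hmul e) := by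
  constructor
  · intro K hI hJ x hx
    have h1 := mem_comapCentralAnnihilator.1 (hI hx)
    have h2 := mem_comapCentralAnnihilator.1 (hJ hx)
    refine (TwoSidedIdeal.mem_bot _).2 (hσ.1 ?_)
    rw [map_zero, ← one_smul (Subring.center B) (σ x), ← hadd, add_smul, h1, h2, add_zero]
  · intro K hI hJ x _
    obtain ⟨y, hy⟩ := hσ.2 (e • σ x)
    obtain ⟨z, hz⟩ := hσ.2 (f • σ x)
    have hxyz : x = y + z := hσ.1 (by rw [map_add, hy, hz, ← add_smul, hadd, one_smul])
    rw [hxyz]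
    refine add_mem (hI (mem_comapCentralAnnihilator.2 ?_)) (hJ (mem_comapCentralAnnihilator.2 ?_))
    · rw [hy, smul_smul, mul_comm, hef, zero_smul]
    · rw [hz, smul_smul, hef, zero_smul]

theorem isCompl_centralAnnihilator {e f : Subring.center B}
    (hadd : e + f = 1) (hef : e * f = 0) :
    IsCompl (centralAnnihilator f) (centralAnnihilator e) := by
  constructor
  · intro K hI hJ x hx
    refine (TwoSidedIdeal.mem_bot _).2 ?_
    rw [← one_smul (Subring.center B) x, ← hadd, add_smul, mem_centralAnnihilator.1 (hI hx),
      mem_centralAnnihilator.1 (hJ hx), add_zero]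
  · intro K hI hJ x _
    rw [← one_smul (Subring.center B) x, ← hadd, add_smul]
    refine add_mem (hI (mem_centralAnnihilator.2 ?_)) (hJ (mem_centralAnnihilator.2 ?_))
    · rw [smul_smul, mul_comm, hef, zero_smul]
    · rw [smul_smul, hef, zero_smul]

theorem exists_directSum_decomposition {σ : A →+ B} (hσ : Function.Bijective σ)
    {e f : Subring.center B} (hmul : ∀ x y, σ (x * y) = e • (σ x * σ y) + f • (σ y * σ x))
    (hadd : e + f = 1) (hef : e * f = 0) :
    ∃ (I J : TwoSidedIdeal A) (I' J' : TwoSidedIdeal B),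
      IsCompl I J ∧ IsCompl I' J' ∧ σ '' (I : Set A) = (I' : Set B) ∧
      σ '' (J : Set A) = (J' : Set B) ∧
      (∀ x ∈ I, ∀ y ∈ I, σ (x * y) = σ x * σ y) ∧
      (∀ x ∈ J, ∀ y ∈ J, σ (x * y) = σ y * σ x) := by
  refine ⟨comapCentralAnnihilator σ hmul f, comapCentralAnnihilator σ hmul e,
    centralAnnihilator f, centralAnnihilator e, isCompl_comapCentralAnnihilator hσ hmul hadd hef,
    isCompl_centralAnnihilator hadd hef, image_comapCentralAnnihilator hσ hmul f,
    image_comapCentralAnnihilator hσ hmul e, fun x hx y hy => ?_, fun x hx y hy => ?_⟩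
  · have h : e = 1 - f := eq_sub_of_add_eq hadd
    rw [hmul, h, sub_smul, one_smul, ← smul_mul_assoc, ← mul_smul_comm,
      mem_comapCentralAnnihilator.1 hx, zero_mul, mul_zero, sub_zero, add_zero]
  · have h : f = 1 - e := eq_sub_of_add_eq' hadd
    rw [hmul, h, sub_smul, one_smul, ← smul_mul_assoc, ← mul_smul_comm,
      mem_comapCentralAnnihilator.1 hx, zero_mul, mul_zero, sub_zero, zero_add]

end DirectSum

section Banach

variable {A B : Type*} [NormedRing A] [NormedAlgebra ℂ A] [NormedRing B] [NormedAlgebra ℂ B]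

theorem IsZeroLieProductDetermined.cyclic_commutator (hzlpd : IsZeroLieProductDetermined A)
    (θ : A →L[ℂ] B) (hcp : ∀ x y : A, x * y - y * x = 0 → θ x * θ y - θ y * θ x = 0)
    (x y z : A) :
    (θ (x * y) * θ z - θ z * θ (x * y)) + (θ (y * z) * θ x - θ x * θ (y * z))
      + (θ (z * x) * θ y - θ y * θ (z * x)) = 0 := by
  refine SeparatingDual.eq_zero_of_forall_dual_eq_zero (R := ℂ) fun f => ?_
  let M : B →L[ℂ] B →L[ℂ] B := ContinuousLinearMap.mul ℂ B - (ContinuousLinearMap.mul ℂ B).flip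
  let φ : A →L[ℂ] A →L[ℂ] ℂ := (ContinuousLinearMap.compL ℂ A B ℂ f).comp (M.bilinearComp θ θ)
  have hφ : ∀ x y, φ x y = f (θ x * θ y - θ y * θ x) := fun x y => by simp [φ, M]
  obtain ⟨ω, hω⟩ := hzlpd φ fun x y hxy => by rw [hφ, hcp x y hxy, map_zero]
  rw [map_add, map_add, ← hφ, ← hφ, ← hφ, hω, hω, hω, ← map_add, ← map_add]
  convert map_zero ω using 2
  noncomm_ring

variable {θ : A →L[ℂ] B} {e : A ≃+ B} {a b : Subring.center B} {μ : A → Subring.center B}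
  {ν : A → A → Subring.center B}

namespace IsQuasiHom

theorem coeff_smul (H : IsQuasiHom e a b μ ν) (he : ∀ x, e x = θ x) (hB : IsDFree B 3)
    (c : ℂ) (x : A) : (μ (c • x) : B) = c • (μ x : B) := by
  refine sub_eq_zero.1 (hB.eq_zero_of_mul_mem_center fun Z => ?_)
  obtain ⟨z, rfl⟩ := e.surjective Z
  have h : e (c • x * z) = c • e (x * z) := by rw [he, he, smul_mul_assoc, map_smul]
  rw [H, H, he, map_smul, ← he] at h
  simp only [Subring.smul_def, smul_eq_mul, mul_one, smul_mul_assoc, mul_smul_comm, smul_add] at h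
  have h' : ((μ (c • x) : B) - c • (μ x : B)) * e z = c • (ν x z : B) - (ν (c • x) z : B) := by
    rw [sub_mul, smul_mul_assoc]
    linear_combination (norm := module) h
  rw [h']
  refine sub_mem ?_ (ν (c • x) z).2
  rw [Algebra.smul_def]
  exact mul_mem (Subring.mem_center_iff.2 fun y => (Algebra.commutes c y).symm) (ν x z).2

/-- The central coefficient `μ` as a linear map. -/
def coeffLinearMap (H : IsQuasiHom e a b μ ν) (he : ∀ x, e x = θ x) (hB : IsDFree B 3) :
    A →ₗ[ℂ] B where
  toFun x := μ x
  map_add' x y := by rw [H.map_add hB, Subring.coe_add]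
  map_smul' c x := H.coeff_smul he hB c x

theorem continuous_coeff [CompleteSpace A] [CompleteSpace B] (H : IsQuasiHom e a b μ ν)
    (he : ∀ x, e x = θ x) (hB : IsDFree B 3) : Continuous (H.coeffLinearMap he hB) := by
  refine LinearMap.continuous_of_seq_closed_graph _ fun u x y hu hy => ?_
  have key : ∀ w (Y : B) t, (μ t : B) * (e w * Y - Y * e w)
      = (θ (w * t) - a * (θ w * θ t) - b * (θ t * θ w) - μ w * θ t) * Y
        - Y * (θ (w * t) - a * (θ w * θ t) - b * (θ t * θ w) - μ w * θ t) := fun w Y t => by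
    have h := H w t
    simp only [Subring.smul_def, smul_eq_mul, mul_one, he] at h
    have c1 := Subring.mem_center_iff.1 (μ t).2 Y
    have c2 := Subring.mem_center_iff.1 (ν w t).2 Y
    have h' : θ (w * t) - a * (θ w * θ t) - b * (θ t * θ w) - μ w * θ t = μ t * θ w + ν w t := by
      rw [h]; abel
    rw [h', he, add_mul, mul_add, ← mul_assoc Y, c1, c2]
    noncomm_ring
  have hlim : ∀ w (Y : B), y * (e w * Y - Y * e w) = μ x * (e w * Y - Y * e w) := fun w Y => by
    refine tendsto_nhds_unique (hy.mul_const _) ?_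
    simp only [Function.comp_def]
    change Filter.Tendsto (fun n => (μ (u n) : B) * (e w * Y - Y * e w)) _ _
    simp only [key w Y]
    exact ((by fun_prop : Continuous fun t => (θ (w * t) - a * (θ w * θ t) - b * (θ t * θ w)
      - μ w * θ t) * Y - Y * (θ (w * t) - a * (θ w * θ t) - b * (θ t * θ w)
      - μ w * θ t)).tendsto x).comp hu
  have h0 := (hB.eq_zero_of_mul_add_mul (E₁ := fun Y => -((y - μ x) * Y))
    (E₂ := fun X => (y - μ x) * X) fun X Y => by
      obtain ⟨w, rfl⟩ := e.surjective X
      have : -((y - μ x) * Y) * e w + (y - μ x) * e w * Y = 0 := by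
        linear_combination (norm := noncomm_ring) hlim w Y
      rw [this]
      exact zero_mem _).2 1
  rw [mul_one] at h0
  exact sub_eq_zero.1 h0

end IsQuasiHom

end Banach

/-- Let `A` and `B` be unital complex Banach algebras, with `A`
semiprime (no nonzero ideal squares to zero) and zero Lie product determined, and with
both `A` and `B` `3`-free.  If `θ : A → B` is a bijective continuous linear map
preserving commutativity, then either
(a) `A` has an ideal `J ⊄ Z(A)` with `θ(J) ⊆ Z(B)`; or
(b) `θ x = λ * σ x + τ x` where `λ ∈ Z(B)` is invertible, `τ : A → Z(B)` is a
continuous linear map, and `σ : A → B` is a continuous bijective linear map that is the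
direct sum of an isomorphism and an antiisomorphism. -/
theorem commutativity_preserving_bijective_linear_map
    (A B : Type*) [NormedRing A] [NormedAlgebra ℂ A] [CompleteSpace A]
    [NormedRing B] [NormedAlgebra ℂ B] [CompleteSpace B]
    (hsemi : ∀ I : TwoSidedIdeal A, (∀ x ∈ I, ∀ y ∈ I, x * y = 0) → I = ⊥)
    (hzlpd : IsZeroLieProductDetermined A)
    (hA3 : IsDFree A 3) (hB3 : IsDFree B 3)
    (θ : A →L[ℂ] B) (hbij : Function.Bijective θ)
    (hcp : ∀ x y : A, x * y - y * x = 0 → θ x * θ y - θ y * θ x = 0) :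
    (∃ J : TwoSidedIdeal A, ¬ (J : Set A) ⊆ Set.center A ∧ ∀ x ∈ J, θ x ∈ Set.center B)
    ∨
    (∃ (lam : B) (τ : A →L[ℂ] B) (σ : A →L[ℂ] B),
        lam ∈ Set.center B ∧ IsUnit lam ∧
        (∀ x : A, τ x ∈ Set.center B) ∧
        Function.Bijective σ ∧
        (∃ (I J : TwoSidedIdeal A) (I' J' : TwoSidedIdeal B),
            IsCompl I J ∧ IsCompl I' J' ∧
            σ '' (I : Set A) = (I' : Set B) ∧
            σ '' (J : Set A) = (J' : Set B) ∧
            (∀ x ∈ I, ∀ y ∈ I, σ (x * y) = σ x * σ y) ∧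
            (∀ x ∈ J, ∀ y ∈ J, σ (x * y) = σ y * σ x)) ∧
        (∀ x : A, θ x = lam * σ x + τ x)) := by
  rw [or_iff_not_imp_left]
  intro hna
  have hna' : ∀ J : TwoSidedIdeal A, (∀ x ∈ J, θ x ∈ Subring.center B) →
      (J : Set A) ⊆ Set.center A := fun J hJ => by
    by_contra hJc
    exact hna ⟨J, hJc, hJ⟩
  let e : A ≃+ B := AddEquiv.ofBijective θ hbij
  have he : ∀ x, e x = θ x := fun x => rfl
  have hcen : ∀ x ∈ Subring.center A, e x ∈ Subring.center B := fun x hx => by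
    refine Subring.mem_center_iff.2 fun Y => ?_
    obtain ⟨y, rfl⟩ := e.surjective Y
    exact sub_eq_zero.1 (hcp y x (sub_eq_zero.2 (Subring.mem_center_iff.1 hx y)))
  obtain ⟨a, b, m, n, hg⟩ := hB3.exists_quasi_polynomial (fun u v => e (e.symm u * e.symm v))
    fun u v w => by
      have h := hzlpd.cyclic_commutator θ hcp (e.symm u) (e.symm v) (e.symm w)
      simpa only [← he, AddEquiv.apply_symm_apply] using h
  have H : IsQuasiHom e a b (fun x => m (e x)) (fun x y => n (e x) (e y)) := fun x y => by
    simpa only [AddEquiv.symm_apply_apply] using hg (e x) (e y)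
  have hinj := H.jordanHom_injective hB3 hA3 hsemi hna'
  have hsurj := H.jordanHom_surjective hB3 hcen hA3 hinj
  obtain ⟨s, hs⟩ := H.isUnit_coeff hB3 hcen hA3 hinj
  let t : Subring.center B := ↑s⁻¹
  have hts : t * (a + b) = 1 := by rw [← hs]; exact s.inv_mul
  have hts' : (t : B) * (a + b : Subring.center B) = 1 := congrArg Subtype.val hts
  let μ : A →L[ℂ] B := ⟨H.coeffLinearMap he hB3, H.continuous_coeff he hB3⟩
  have hμ : ∀ x, μ x = m (e x) := fun x => rfl
  let σ : A →L[ℂ] B := (ContinuousLinearMap.mul ℂ B (a + b : Subring.center B)).comp θ + μ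
  have hσ : ∀ x, σ x = H.jordanHom hB3 x := fun x => by
    rw [H.jordanHom_apply, Subring.smul_def, Subring.smul_def, smul_eq_mul, smul_eq_mul, mul_one]
    rfl
  have hσ' : ⇑σ = H.jordanHom hB3 := funext hσ
  have hmul : ∀ x y, H.jordanHom hB3 (x * y)
      = (t * a) • (H.jordanHom hB3 x * H.jordanHom hB3 y)
        + (t * b) • (H.jordanHom hB3 y * H.jordanHom hB3 x) := fun x y => by
    rw [← one_smul (Subring.center B) (H.jordanHom hB3 (x * y)), ← hts, mul_smul,
      H.smul_jordanHom_mul, smul_add, mul_smul, mul_smul]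
  refine ⟨t, -(ContinuousLinearMap.mul ℂ B t).comp μ, σ, t.2, ?_, fun x => ?_, ?_, ?_, fun x => ?_⟩
  · exact s⁻¹.isUnit.map (Subring.center B).subtype
  · exact neg_mem (s := Subring.center B) (mul_mem t.2 (m (e x)).2)
  · rw [hσ']
    exact ⟨hinj, hsurj⟩
  · simp only [hσ']
    exact exists_directSum_decomposition ⟨hinj, hsurj⟩ hmul (by rw [← mul_add, hts])
      (by linear_combination t * t * H.mul_eq_zero hB3)
  · change θ x = t * ((a + b : Subring.center B) * θ x + μ x) + -(t * μ x)
    rw [mul_add, ← mul_assoc, hts', one_mul, add_neg_cancel_right]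
end

section
/- Let A be a semiprimitive complex Banach algebra. If a, b ∈ A are such that the commutator [a,b] = ab − ba lies in the center Z(A) of A, then [a,b] = 0. -/
/-- If `c = a * b - b * a` commutes with `b`, then `a` acts by commutators on powers of `b` as
`c` times formal differentiation. -/
theorem mul_pow_succ_sub_pow_succ_mul {R : Type*} [Ring R] {a b c : R}
    (hc : a * b - b * a = c) (hb : Commute c b) (n : ℕ) :
    a * b ^ (n + 1) - b ^ (n + 1) * a = (n + 1) • (c * b ^ n) := by
  induction n with
  | zero => simpa using hc
  | succ n ih =>
    calc a * b ^ (n + 1 + 1) - b ^ (n + 1 + 1) * a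
        = (a * b ^ (n + 1) - b ^ (n + 1) * a) * b + b ^ (n + 1) * (a * b - b * a) := by
          rw [pow_succ b (n + 1)]; noncomm_ring
      _ = (n + 1 + 1) • (c * b ^ (n + 1)) := by
          rw [ih, hc, ← (hb.pow_right (n + 1)).eq, smul_mul_assoc, mul_assoc, ← pow_succ,
            succ_nsmul _ (n + 1)]

/-- Quantitative Kleinecke–Shirokov estimate for a commutator `c = a * b - b * a` that commutes
with `a` and `b`. -/
theorem factorial_mul_norm_mul_commutator_pow_le {A : Type*} [NormedRing A] [NormedAlgebra ℝ A]
    {a b c : A} (hc : a * b - b * a = c) (ha : Commute c a) (hb : Commute c b) (n : ℕ)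
    {z : A} (hz : Commute z a) :
    (n.factorial : ℝ) * ‖z * c ^ n‖ ≤ (2 * ‖a‖) ^ n * ‖z * b ^ n‖ := by
  induction n generalizing z with
  | zero => simp
  | succ n ih =>
    have key : a * (z * b ^ (n + 1)) - z * b ^ (n + 1) * a = (n + 1) • (z * c * b ^ n) := by
      rw [← mul_assoc, ← hz.eq, mul_assoc, mul_assoc, ← mul_sub,
        mul_pow_succ_sub_pow_succ_mul hc hb, mul_smul_comm, mul_assoc]
    have bound : ((n : ℝ) + 1) * ‖z * c * b ^ n‖ ≤ 2 * ‖a‖ * ‖z * b ^ (n + 1)‖ := by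
      have h1 : ((n : ℝ) + 1) * ‖z * c * b ^ n‖ = ‖(n + 1) • (z * c * b ^ n)‖ := by
        rw [← Nat.cast_smul_eq_nsmul ℝ, norm_smul, Real.norm_natCast, Nat.cast_succ]
      rw [h1, ← key]
      linarith [norm_sub_le (a * (z * b ^ (n + 1))) (z * b ^ (n + 1) * a),
        norm_mul_le a (z * b ^ (n + 1)), norm_mul_le (z * b ^ (n + 1)) a,
        mul_comm ‖a‖ ‖z * b ^ (n + 1)‖]
    calc ((n + 1).factorial : ℝ) * ‖z * c ^ (n + 1)‖
        = (n + 1) * (n.factorial * ‖z * c * c ^ n‖) := by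
          rw [Nat.factorial_succ, pow_succ', mul_assoc z]; push_cast; ring
      _ ≤ (n + 1) * ((2 * ‖a‖) ^ n * ‖z * c * b ^ n‖) :=
          mul_le_mul_of_nonneg_left (ih (hz.mul_left ha)) (by positivity)
      _ = (2 * ‖a‖) ^ n * ((n + 1) * ‖z * c * b ^ n‖) := by ring
      _ ≤ (2 * ‖a‖) ^ n * (2 * ‖a‖ * ‖z * b ^ (n + 1)‖) := by gcongr
      _ = (2 * ‖a‖) ^ (n + 1) * ‖z * b ^ (n + 1)‖ := by ring

/-- In a complete normed ring, `1 - x` is left invertible as soon as some power of `x` has norm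
less than one. -/
theorem exists_mul_one_sub_eq_one_of_norm_pow_lt_one {A : Type*} [NormedRing A] [CompleteSpace A]
    {x : A} {n : ℕ} (hx : ‖x ^ n‖ < 1) : ∃ z, z * (1 - x) = 1 := by
  obtain ⟨u, hu⟩ := isUnit_one_sub_of_norm_lt_one hx
  refine ⟨↑u⁻¹ * ∑ i ∈ Finset.range n, x ^ i, ?_⟩
  rw [mul_assoc, geom_sum_mul_neg, ← hu, Units.inv_mul]

/-- Let `A` be a semiprimitive complex Banach algebra (the Jacobson
radical of `A` is zero).  If `a b : A` are such that the commutator `a*b - b*a` lies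
in the center of `A`, then `a*b - b*a = 0`. -/
theorem commutator_in_center_eq_zero
    (A : Type*) [NormedRing A] [NormedAlgebra ℂ A] [CompleteSpace A]
    (hsp : (⊥ : Ideal A).jacobson = ⊥)
    (a b : A) (h : a * b - b * a ∈ Set.center A) :
    a * b - b * a = 0 := by
  let _ : NormedAlgebra ℝ A := NormedAlgebra.restrictScalars ℝ ℂ A
  obtain ⟨c, hc⟩ : ∃ c, a * b - b * a = c := ⟨_, rfl⟩
  rw [hc] at h ⊢
  have comm (x : A) : Commute c x := (Set.mem_center_iff.mp h).comm x
  rw [← Ideal.mem_bot, ← hsp, Ideal.mem_jacobson_iff]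
  intro y
  obtain ⟨n, hn, hn0⟩ : ∃ n : ℕ, (‖y‖ * (2 * ‖a‖ * ‖b‖)) ^ n / n.factorial < 1 ∧ 0 < n :=
    (((FloorSemiring.tendsto_pow_div_factorial_atTop _).eventually_lt_const one_pos).and
      (Filter.eventually_gt_atTop 0)).exists
  have hpow : ‖(-(y * c)) ^ n‖ < 1 := by
    refine lt_of_le_of_lt ?_ hn
    rw [le_div_iff₀ (by positivity)]
    have hcn := factorial_mul_norm_mul_commutator_pow_le hc (comm a) (comm b) n
      (Commute.one_left a)
    rw [one_mul, one_mul] at hcn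
    calc ‖(-(y * c)) ^ n‖ * n.factorial = ‖y ^ n * c ^ n‖ * n.factorial := by
          rw [← (comm y).symm.mul_pow]
          rcases n.even_or_odd with e | e <;> simp [e.neg_pow]
      _ ≤ ‖y ^ n‖ * ‖c ^ n‖ * n.factorial := by gcongr; exact norm_mul_le _ _
      _ = ‖y ^ n‖ * (n.factorial * ‖c ^ n‖) := by ring
      _ ≤ ‖y‖ ^ n * ((2 * ‖a‖) ^ n * ‖b‖ ^ n) := by
          refine mul_le_mul (norm_pow_le' y hn0) (hcn.trans ?_) (by positivity) (by positivity)
          gcongr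
          exact norm_pow_le' b hn0
      _ = (‖y‖ * (2 * ‖a‖ * ‖b‖)) ^ n := by ring
  obtain ⟨z, hz⟩ := exists_mul_one_sub_eq_one_of_norm_pow_lt_one hpow
  refine ⟨z, ?_⟩
  rw [Ideal.mem_bot, ← hz]
  noncomm_ring
end

section
/- Let A be a unital semiprime ring and let a, x ∈ A be such that a·y·a commutes with x for every y ∈ A (i.e., (aya)x = x(aya) for all y ∈ A). Then a·A·[a,x]·A·a = {0}, [a,x]·A·[a,x]·A·[a,x] = {0}, and consequently [a,x] = 0. -/
/-- In a semiprime ring, `b * A * b = 0` forces `b = 0`. -/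
theorem eq_zero_of_forall_mul_mul_eq_zero_s5 {A : Type*} [Ring A]
    (hsemi : ∀ I : TwoSidedIdeal A, (∀ x ∈ I, ∀ y ∈ I, x * y = 0) → I = ⊥)
    {b : A} (hb : ∀ r : A, b * r * b = 0) : b = 0 := by
  have hright {v : A} (hv : v ∈ TwoSidedIdeal.span {b}) (r : A) : b * r * v = 0 := by
    induction hv using TwoSidedIdeal.span_induction generalizing r with
    | mem v hv => rw [Set.mem_singleton_iff.1 hv, hb]
    | zero => rw [mul_zero]
    | add v w _ _ hv hw => rw [mul_add, hv, hw, add_zero]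
    | neg v _ hv => rw [mul_neg, hv, neg_zero]
    | left_absorb t v _ hv => rw [← mul_assoc, mul_assoc b, hv]
    | right_absorb t v _ hv => rw [← mul_assoc, hv, zero_mul]
  have hspan : TwoSidedIdeal.span {b} = (⊥ : TwoSidedIdeal A) := by
    refine hsemi _ fun u hu v hv => ?_
    induction hu using TwoSidedIdeal.span_induction generalizing v with
    | mem u hu => rw [Set.mem_singleton_iff.1 hu, ← mul_one b, hright hv]
    | zero => rw [zero_mul]
    | add u w _ _ hu hw => rw [add_mul, hu v hv, hw v hv, add_zero]
    | neg u _ hu => rw [neg_mul, hu v hv, neg_zero]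
    | left_absorb t u _ hu => rw [mul_assoc, hu v hv, mul_zero]
    | right_absorb t u _ hu => rw [mul_assoc, hu _ (TwoSidedIdeal.mul_mem_left _ _ _ hv)]
  have hmem : b ∈ (⊥ : TwoSidedIdeal A) := hspan ▸ TwoSidedIdeal.subset_span rfl
  simpa using hmem

/-- Let `A` be a unital semiprime ring (no nonzero two-sided ideal
squares to zero) and `a x : A` such that `a*y*a` commutes with `x` for all `y : A`.
Then `a·A·[a,x]·A·a = {0}`, `[a,x]·A·[a,x]·A·[a,x] = {0}`, and `[a,x] = 0`. -/
theorem aya_commutes_imp_commutator_zero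
    (A : Type*) [Ring A]
    (hsemi : ∀ I : TwoSidedIdeal A, (∀ x ∈ I, ∀ y ∈ I, x * y = 0) → I = ⊥)
    (a x : A) (h : ∀ y : A, a * y * a * x = x * (a * y * a)) :
    (∀ r s : A, a * r * (a * x - x * a) * s * a = 0) ∧
    (∀ r s : A, (a * x - x * a) * r * (a * x - x * a) * s * (a * x - x * a) = 0) ∧
    a * x - x * a = 0 := by
  have hac (r s : A) : a * r * (a * x - x * a) * s * a = 0 :=
    calc a * r * (a * x - x * a) * s * a
        = a * r * a * x * (s * a) - a * r * (x * (a * s * a)) := by noncomm_ring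
      _ = x * (a * r * a) * (s * a) - a * (r * a * s) * a * x := by
        rw [h r, ← h s]; noncomm_ring
      _ = 0 := by rw [h (r * a * s)]; noncomm_ring
  have hccc (r s : A) :
      (a * x - x * a) * r * (a * x - x * a) * s * (a * x - x * a) = 0 := by
    obtain ⟨c, hc⟩ : ∃ c, c = a * x - x * a := ⟨_, rfl⟩
    rw [← hc] at hac
    calc (a * x - x * a) * r * (a * x - x * a) * s * (a * x - x * a)
        = (a * x - x * a) * r * c * s * (a * x - x * a) := by rw [hc]
      _ = a * (x * r) * c * s * a * x - a * (x * r) * c * (s * x) * a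
          - x * (a * r * c * s * a) * x + x * (a * r * c * (s * x) * a) := by noncomm_ring
      _ = 0 := by simp only [hac, zero_mul, mul_zero, sub_zero, add_zero]
  refine ⟨hac, hccc, ?_⟩
  refine eq_zero_of_forall_mul_mul_eq_zero_s5 hsemi fun s =>
    eq_zero_of_forall_mul_mul_eq_zero_s5 hsemi fun r => ?_
  generalize a * x - x * a = c at hccc ⊢
  calc c * s * c * r * (c * s * c) = c * s * c * r * c * (s * c) := by noncomm_ring
    _ = 0 := by rw [hccc, zero_mul]
end

section
/- Let A be a semiprimitive complex Banach algebra and let d be a derivation of A satisfying [d(x),x] = 0 for all x ∈ A. Then d = 0. -/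
section Algebra

variable {A : Type*} [Ring A]

/-- A ring with zero Jacobson radical is semiprime. -/
theorem eq_zero_of_mul_mul_self_eq_zero (hsp : (⊥ : Ideal A).jacobson = ⊥) {a : A}
    (h : ∀ w, a * w * a = 0) : a = 0 := by
  have : a ∈ (⊥ : Ideal A).jacobson := by
    rw [Ideal.mem_jacobson_iff]
    intro y
    refine ⟨1 - y * a, ?_⟩
    have h' : y * (a * y * a) = 0 := by rw [h, mul_zero]
    rw [Ideal.mem_bot]
    calc (1 - y * a) * y * a + (1 - y * a) - 1 = - (y * (a * y * a)) := by noncomm_ring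
      _ = 0 := by rw [h', neg_zero]
  rwa [hsp, Ideal.mem_bot] at this

/-- A commuting derivation of a ring with zero Jacobson radical takes central values. -/
theorem commute_of_commuting_derivation (hsp : (⊥ : Ideal A).jacobson = ⊥)
    (d : A →+ A) (hleib : ∀ x y : A, d (x * y) = d x * y + x * d y)
    (hcomm : ∀ x : A, d x * x - x * d x = 0) (x y : A) : d x * y = y * d x := by
  have hlin (x y : A) : d x * y - y * d x = x * d y - d y * x := by
    have h := hcomm (x + y)
    rw [map_add] at h
    rw [← sub_eq_zero]
    calc d x * y - y * d x - (x * d y - d y * x)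
        = ((d x + d y) * (x + y) - (x + y) * (d x + d y)) - (d x * x - x * d x)
          - (d y * y - y * d y) := by noncomm_ring
      _ = 0 := by rw [h, hcomm, hcomm]; simp
  have hself (x z : A) : d x * (x * z - z * x) = 0 := by
    have h₁ := hlin x (x * z)
    have h₂ := hlin x z
    rw [hleib] at h₁
    rw [← sub_eq_zero] at h₁ h₂
    calc d x * (x * z - z * x)
        = x * (d x * z - z * d x - (x * d z - d z * x)) + (d x * x - x * d x) * z
          - (d x * (x * z) - x * z * d x
            - (x * (d x * z + x * d z) - (d x * z + x * d z) * x))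
          + (d x * x - x * d x) * z := by noncomm_ring
      _ = 0 := by rw [h₁, h₂, hcomm]; simp
  have hmid (x w z : A) : d x * w * (x * z - z * x) = 0 := by
    calc d x * w * (x * z - z * x)
        = d x * (x * (w * z) - w * z * x) - d x * (x * w - w * x) * z := by noncomm_ring
      _ = 0 := by rw [hself, hself]; simp
  have hpol (x y w z : A) : d x * w * (y * z - z * y) = - (d y * w * (x * z - z * x)) := by
    have h := hmid (x + y) w z
    rw [map_add] at h
    rw [← sub_eq_zero]
    calc d x * w * (y * z - z * y) - - (d y * w * (x * z - z * x))
        = (d x + d y) * w * ((x + y) * z - z * (x + y)) - d x * w * (x * z - z * x)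
          - d y * w * (y * z - z * y) := by noncomm_ring
      _ = 0 := by rw [h, hmid, hmid]; simp
  have hall (x y w z : A) : d x * w * (y * z - z * y) = 0 := by
    refine eq_zero_of_mul_mul_self_eq_zero hsp fun v => ?_
    calc d x * w * (y * z - z * y) * v * (d x * w * (y * z - z * y))
        = d x * w * (y * z - z * y) * v * - (d y * w * (x * z - z * x)) := by
          rw [hpol x y w z]
      _ = - (d x * (w * (y * z - z * y) * v * d y * w) * (x * z - z * x)) := by noncomm_ring
      _ = 0 := by rw [hmid, neg_zero]
  rw [← sub_eq_zero]
  refine eq_zero_of_mul_mul_self_eq_zero hsp fun v => ?_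
  calc (d x * y - y * d x) * v * (d x * y - y * d x)
      = d x * (y * v) * (d x * y - y * d x) - y * (d x * v * (d x * y - y * d x)) := by
        noncomm_ring
    _ = 0 := by rw [hall, hall]; simp

end Algebra

section Commutative

/-- A discontinuous linear functional takes arbitrarily large values on arbitrarily small
vectors, also after translation. -/
theorem LinearMap.exists_small_large_of_not_continuous {E : Type*} [NormedAddCommGroup E]
    [NormedSpace ℂ E] (ψ : E →ₗ[ℂ] ℂ) (hψ : ¬ Continuous ψ) {ε : ℝ} (hε : 0 < ε)
    (c : ℂ) (C : ℝ) : ∃ y, ‖y‖ ≤ ε ∧ C ≤ ‖c + ψ y‖ := by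
  by_contra! h
  refine hψ ?_
  obtain ⟨K, hK⟩ := LinearMap.bound_of_ball_bound hε (C + ‖c‖) ψ fun z hz => by
    have h₁ := h z (by simpa using (mem_ball_zero_iff.1 hz).le)
    have h₂ := norm_sub_le (c + ψ z) c
    rw [add_sub_cancel_left] at h₂
    linarith
  exact (ψ.mkContinuous K hK).continuous

variable {B : Type*} [NormedCommRing B]

/-- Multiplying by a product of contractions does not increase the norm. -/
theorem norm_prod_mul_le (c : ℕ → B) (hc : ∀ n, ‖c n‖ ≤ 1) (m : ℕ) (y : B) :
    ‖(∏ j ∈ Finset.range m, c j) * y‖ ≤ ‖y‖ := by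
  induction m generalizing y with
  | zero => simp
  | succ m ih =>
    rw [Finset.prod_range_succ, mul_assoc]
    refine (ih _).trans ((norm_mul_le _ _).trans ?_)
    exact mul_le_of_le_one_left (norm_nonneg _) (hc m)

variable [NormedAlgebra ℂ B]

/-- The leading term of `d^k (x ^ (k + m))` modulo `x ^ (m + 1)`. -/
theorem Derivation.factorial_mul_iterate_pow (d : Derivation ℂ B B) (x : B) (k m : ℕ) :
    ∃ r, (m.factorial : B) * d^[k] (x ^ (k + m))
      = ((k + m).factorial : B) * (x ^ m * d x ^ k) + x ^ (m + 1) * r := by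
  induction k generalizing m with
  | zero => exact ⟨0, by simp⟩
  | succ k ih =>
    obtain ⟨r, hr⟩ := ih (m + 1)
    have h := congrArg d hr
    have hm : ((m + 1 : ℕ) : B) = algebraMap ℂ B ((m + 1 : ℕ) : ℂ) := by simp
    have hunit : IsUnit ((m + 1 : ℕ) : B) := by
      rw [hm]
      exact (isUnit_iff_ne_zero.2 (Nat.cast_ne_zero.2 m.succ_ne_zero)).map _
    obtain ⟨q, hq⟩ := hunit.exists_right_inv
    refine ⟨q * (((k + (m + 1)).factorial : B) * ((k : B) * (d x ^ (k - 1) * d (d x))) + x * d r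
      + ((m + 2 : ℕ) : B) * r * d x), ?_⟩
    refine hunit.mul_left_cancel ?_
    rw [Function.iterate_succ_apply', show k + 1 + m = k + (m + 1) by ring]
    simp only [Derivation.leibniz, map_add, Derivation.map_natCast, smul_eq_mul, mul_zero,
      add_zero, Derivation.leibniz_pow, Nat.factorial_succ m, Nat.cast_mul,
      Nat.add_sub_cancel, nsmul_eq_mul] at h ⊢
    linear_combination h - x ^ (m + 1) * (((k + (m + 1)).factorial : B) * ((k : B) * (d x ^ (k - 1) * d (d x))) + x * d r
      + ((m + 2 : ℕ) : B) * r * d x) * hq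

variable [CompleteSpace B]

/-- Distinct characters of a Banach algebra are separated, all at once, by one element as soon
as there are countably many of them. -/
theorem exists_injective_apply (f : ℕ → B →ₐ[ℂ] ℂ)
    (hf : Function.Injective f) : ∃ a : B, Function.Injective fun n => f n a := by
  have hcont (n : ℕ) : Continuous (f n) := map_continuous (f n)
  let U : {p : ℕ × ℕ // p.1 ≠ p.2} → Set B := fun p => {a | f p.1.1 a ≠ f p.1.2 a}
  have ho : ∀ p, IsOpen (U p) := fun p => isOpen_ne_fun (hcont _) (hcont _)
  have hd : ∀ p, Dense (U p) := by
    rintro ⟨⟨m, n⟩, hmn⟩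
    have hU : U ⟨(m, n), hmn⟩
        = ((LinearMap.ker ((f m).toLinearMap - (f n).toLinearMap) : Submodule ℂ B) : Set B)ᶜ := by
      ext a
      simp [U, sub_eq_zero]
    rw [hU, ← interior_eq_empty_iff_dense_compl, ← Set.not_nonempty_iff_eq_empty]
    intro hne
    have htop := Submodule.eq_top_of_nonempty_interior' _ hne
    refine hmn (hf (AlgHom.ext fun a => ?_))
    have : a ∈ LinearMap.ker ((f m).toLinearMap - (f n).toLinearMap) := htop ▸ Submodule.mem_top
    simpa [sub_eq_zero] using this
  obtain ⟨a, ha⟩ := (dense_iInter_of_isOpen ho hd).nonempty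
  refine ⟨a, fun m n hmn => ?_⟩
  by_contra hne
  exact Set.mem_iInter.1 ha ⟨(m, n), hne⟩ hmn

/-- Gliding hump: only finitely many characters have a discontinuous composition with a given
derivation. -/
theorem Derivation.finite_setOf_not_continuous_comp (d : Derivation ℂ B B) :
    {φ : B →ₐ[ℂ] ℂ | ¬ Continuous fun x => φ (d x)}.Finite := by
  by_contra hinf
  have hinf : {φ : B →ₐ[ℂ] ℂ | ¬ Continuous fun x => φ (d x)}.Infinite := hinf
  let f : ℕ → B →ₐ[ℂ] ℂ := fun n => (hinf.natEmbedding _ n : B →ₐ[ℂ] ℂ)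
  have hfinj : Function.Injective f :=
    Subtype.val_injective.comp (hinf.natEmbedding _).injective
  have hfd (n : ℕ) : ¬ Continuous fun x => f n (d x) := (hinf.natEmbedding _ n).2
  have hfb (n : ℕ) (a : B) : ‖f n a‖ ≤ ‖a‖ * ‖(1 : B)‖ :=
    AlgHom.norm_apply_le_self_mul_norm_one (f n) a
  -- contractions `c n` with `f n (c n) = 0` and `f m (c n) ≠ 0` for `m ≠ n`
  obtain ⟨c, hc, hc0, hcne⟩ : ∃ c : ℕ → B, (∀ n, ‖c n‖ ≤ 1) ∧ (∀ n, f n (c n) = 0) ∧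
      ∀ m n, m ≠ n → f m (c n) ≠ 0 := by
    obtain ⟨a, ha⟩ := exists_injective_apply f hfinj
    let K : ℝ := 1 + (‖a‖ + ‖a‖ * ‖(1 : B)‖ * ‖(1 : B)‖)
    have hK : 0 < K := by positivity
    refine ⟨fun n => ((K⁻¹ : ℝ) : ℂ) • (a - algebraMap ℂ B (f n a)), fun n => ?_, fun n => ?_,
      fun m n hmn => ?_⟩
    · rw [norm_smul, Complex.norm_real, Real.norm_of_nonneg (inv_nonneg.2 hK.le),
        inv_mul_le_iff₀ hK, mul_one]
      have h₁ := norm_sub_le a (algebraMap ℂ B (f n a))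
      have h₂ : ‖algebraMap ℂ B (f n a)‖ ≤ ‖a‖ * ‖(1 : B)‖ * ‖(1 : B)‖ := by
        rw [norm_algebraMap]
        exact mul_le_mul_of_nonneg_right (hfb n a) (norm_nonneg _)
      simp only [K]
      linarith
    · simp
    · have : f m a - f n a ≠ 0 := sub_ne_zero.2 fun h => hmn (ha h)
      simp [this, hK.ne']
  let p : ℕ → B := fun n => ∏ j ∈ Finset.range n, c j ^ 2
  have hp (n : ℕ) : p (n + 1) = p n * c n ^ 2 := Finset.prod_range_succ _ _
  have hfp (n : ℕ) : f n (p n) ≠ 0 := by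
    simp only [p, map_prod, map_pow]
    refine Finset.prod_ne_zero_iff.2 fun j hj => pow_ne_zero _ (hcne _ _ ?_)
    exact (Finset.mem_range.1 hj).ne'
  have hdp (n : ℕ) (w : B) : f n (d (p (n + 1) * w)) = 0 := by
    rw [hp, show p n * c n ^ 2 * w = c n * (c n * (p n * w)) by ring]
    simp [Derivation.leibniz, hc0]
  have hstep (n : ℕ) (s : B) :
      ∃ y, ‖y‖ ≤ (1 / 2 : ℝ) ^ n ∧ (n : ℝ) ≤ ‖f n (d (s + p n * y))‖ := by
    let ψ : B →ₗ[ℂ] ℂ :=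
      (f n).toLinearMap ∘ₗ (d : B →ₗ[ℂ] B) ∘ₗ LinearMap.mulLeft ℂ (p n)
    have hψ : ¬ Continuous ψ := by
      intro h
      refine hfd n ?_
      have heq : (fun x => f n (d x))
          = fun x => (f n (p n))⁻¹ * (ψ x - f n x * f n (d (p n))) := by
        ext x
        have := hfp n
        simp [ψ, Derivation.leibniz]
        field_simp
      rw [heq]
      have := map_continuous (f n)
      fun_prop
    obtain ⟨y, hy, hy'⟩ := ψ.exists_small_large_of_not_continuous hψ
      (show (0 : ℝ) < (1 / 2) ^ n by positivity) (f n (d s)) n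
    exact ⟨y, hy, by simpa [ψ] using hy'⟩
  choose g hg hgn using hstep
  let s : ℕ → B := fun n => Nat.rec 0 (fun n s => s + p n * g n s) n
  let y : ℕ → B := fun n => g n (s n)
  have hs (n : ℕ) : s (n + 1) = s n + p n * y n := rfl
  let T : ℕ → ℕ → B := fun n m => (∏ j ∈ Finset.range m, c (n + j) ^ 2) * y (n + m)
  have hT (n : ℕ) : Summable (T n) := by
    refine Summable.of_norm_bounded (g := fun m => (1 / 2 : ℝ) ^ m)
      (summable_geometric_of_lt_one (by norm_num) (by norm_num)) fun m => ?_
    refine (norm_prod_mul_le (fun j => c (n + j) ^ 2) (fun j => ?_) m _).trans ?_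
    · rw [pow_two]
      exact (norm_mul_le _ _).trans (mul_le_one₀ (hc _) (norm_nonneg _) (hc _))
    · refine (hg _ _).trans ?_
      exact pow_le_pow_of_le_one (by norm_num) (by norm_num) (Nat.le_add_left _ _)
  let t : ℕ → B := fun n => ∑' m, T n m
  have ht (n : ℕ) : t n = y n + c n ^ 2 * t (n + 1) := by
    simp only [t]
    rw [(hT n).tsum_eq_zero_add, ← (hT (n + 1)).tsum_mul_left]
    congr 1
    · simp [T]
    · refine tsum_congr fun m => ?_
      have hadd (j : ℕ) : n + 1 + j = n + (j + 1) := by ring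
      simp only [T, Finset.prod_range_succ', hadd, add_zero]
      ring
  have hx (n : ℕ) : t 0 = s n + p n * t n := by
    induction n with
    | zero => simp [s, p]
    | succ n ih => rw [ih, hs, hp, ht n]; ring
  obtain ⟨n, hn⟩ := exists_nat_gt (‖d (t 0)‖ * ‖(1 : B)‖)
  have h₁ : f n (d (t 0)) = f n (d (s n + p n * y n)) := by
    rw [hx (n + 1), hs, map_add d, map_add (f n), hdp, add_zero]
  have h₂ := hgn n (s n)
  rw [← h₁] at h₂
  linarith [hfb n (d (t 0))]

/-- In a commutative Banach algebra whose characters separate points, every derivation is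
continuous. -/
theorem Derivation.continuous_of_characters_separate
    (hss : ∀ b : B, (∀ φ : B →ₐ[ℂ] ℂ, φ b = 0) → b = 0) (d : Derivation ℂ B B) :
    Continuous d := by
  classical
  have hF := d.finite_setOf_not_continuous_comp
  refine LinearMap.continuous_of_seq_closed_graph (g := (d : B →ₗ[ℂ] B)) fun u x y hu hdu => ?_
  suffices h : y - d x = 0 from sub_eq_zero.1 h
  set z := y - d x with hz
  have hzero (φ : B →ₐ[ℂ] ℂ) (hφ : Continuous fun x => φ (d x)) : φ z = 0 := by
    have h₁ : Filter.Tendsto (fun n => φ (d (u n))) Filter.atTop (nhds (φ y)) :=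
      ((map_continuous φ).tendsto y).comp hdu
    have h₂ : Filter.Tendsto (fun n => φ (d (u n))) Filter.atTop (nhds (φ (d x))) :=
      (hφ.tendsto x).comp hu
    rw [hz, map_sub, tendsto_nhds_unique h₁ h₂, sub_self]
  by_contra hne
  obtain ⟨χ, hχ⟩ : ∃ χ : B →ₐ[ℂ] ℂ, χ z ≠ 0 := by
    by_contra! h
    exact hne (hss z h)
  have hsep (φ : B →ₐ[ℂ] ℂ) : ∃ b, φ ≠ χ → φ b ≠ χ b := by
    by_cases h : φ = χ
    · exact ⟨0, fun h' => absurd h h'⟩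
    · obtain ⟨b, hb⟩ := DFunLike.ne_iff.1 h
      exact ⟨b, fun _ => hb⟩
  choose b hb using hsep
  let v : B := z * ∏ φ ∈ hF.toFinset.erase χ, (b φ - algebraMap ℂ B (φ (b φ)))
  have hvχ : χ v ≠ 0 := by
    simp only [v, map_mul, map_prod, map_sub, AlgHom.commutes]
    refine mul_ne_zero hχ (Finset.prod_ne_zero_iff.2 fun φ hφ => ?_)
    exact sub_ne_zero.2 (hb φ (Finset.ne_of_mem_erase hφ)).symm
  have hv (φ : B →ₐ[ℂ] ℂ) (hφ : φ ≠ χ) : φ v = 0 := by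
    by_cases hc : Continuous fun x => φ (d x)
    · simp only [v, map_mul, hzero φ hc, zero_mul]
    · simp only [v, map_mul, map_prod]
      rw [Finset.prod_eq_zero (i := φ) (Finset.mem_erase.2 ⟨hφ, hF.mem_toFinset.2 hc⟩)
        (by simp), mul_zero]
  -- `v` is a multiple of a minimal idempotent supported at `χ`
  have hmul (a : B) : a * v = χ a • v := by
    refine sub_eq_zero.1 (hss _ fun φ => ?_)
    by_cases h : φ = χ
    · subst h; simp
    · simp [hv φ h]
  let e : B := (χ v)⁻¹ • v
  have he (a : B) : a * e = χ a • e := by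
    simp only [e, mul_smul_comm, hmul, smul_comm (χ a)]
  have hχe : χ e = 1 := by simp [e, hvχ]
  have hee : e * e = e := by rw [he, hχe, one_smul]
  have hχde : χ (d e) = 0 := by
    have h := congrArg (fun w => χ (d w)) hee
    simp only [Derivation.leibniz, smul_eq_mul, map_add, map_mul, hχe, one_mul] at h
    simpa using h
  have hχd (a : B) : χ (d a) = 0 := by
    have h := congrArg (fun w => χ (d w)) (he a)
    simpa [Derivation.leibniz, hχe, hχde] using h
  exact hχ (hzero χ (by simpa only [hχd] using continuous_const))

/-- Singer–Wermer: characters annihilate the range of a continuous derivation. -/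
theorem Derivation.character_apply_eq_zero (d : Derivation ℂ B B) (hd : Continuous d)
    (φ : B →ₐ[ℂ] ℂ) (x : B) : φ (d x) = 0 := by
  suffices h : ∀ x, φ x = 0 → φ (d x) = 0 by
    have := h (x - algebraMap ℂ B (φ x)) (by simp)
    simpa using this
  intro x hx
  by_contra hne
  let D : B →L[ℂ] B := ⟨(d : B →ₗ[ℂ] B), hd⟩
  have hiter (n : ℕ) (b : B) : ‖d^[n] b‖ ≤ ‖D‖ ^ n * ‖b‖ := by
    induction n with
    | zero => simp
    | succ n ih =>
      rw [Function.iterate_succ_apply', pow_succ', mul_assoc]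
      exact (D.le_opNorm _).trans (mul_le_mul_of_nonneg_left ih (norm_nonneg _))
  have hval (n : ℕ) : φ (d^[n] (x ^ n)) = n.factorial * φ (d x) ^ n := by
    obtain ⟨r, hr⟩ := d.factorial_mul_iterate_pow x n 0
    have := congrArg φ hr
    simpa [hx] using this
  have hδ : 0 < ‖φ (d x)‖ := norm_pos_iff.2 hne
  have hbound (n : ℕ) (hn : 0 < n) :
      1 ≤ ‖(1 : B)‖ * ((‖D‖ * ‖x‖ / ‖φ (d x)‖) ^ n / n.factorial) := by
    have h₁ : (n.factorial : ℝ) * ‖φ (d x)‖ ^ n ≤ ‖D‖ ^ n * ‖x‖ ^ n * ‖(1 : B)‖ := by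
      calc (n.factorial : ℝ) * ‖φ (d x)‖ ^ n = ‖φ (d^[n] (x ^ n))‖ := by
            rw [hval, norm_mul, norm_pow, Complex.norm_natCast]
        _ ≤ ‖d^[n] (x ^ n)‖ * ‖(1 : B)‖ := AlgHom.norm_apply_le_self_mul_norm_one φ _
        _ ≤ ‖D‖ ^ n * ‖x‖ ^ n * ‖(1 : B)‖ := by
            gcongr
            refine (hiter n _).trans ?_
            gcongr
            exact norm_pow_le' x hn
    have hfac : (0 : ℝ) < n.factorial := by exact_mod_cast n.factorial_pos
    rw [div_pow, mul_pow, div_div, mul_div_assoc', le_div_iff₀ (by positivity)]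
    linarith
  have hlim := (FloorSemiring.tendsto_pow_div_factorial_atTop
    (‖D‖ * ‖x‖ / ‖φ (d x)‖)).const_mul ‖(1 : B)‖
  rw [mul_zero] at hlim
  have h₁ := ge_of_tendsto hlim (Filter.eventually_atTop.2 ⟨1, fun n hn => hbound n hn⟩)
  linarith

/-- A commutative Banach algebra whose characters separate points has no nonzero derivation. -/
theorem Derivation.eq_zero_of_characters_separate
    (hss : ∀ b : B, (∀ φ : B →ₐ[ℂ] ℂ, φ b = 0) → b = 0) (d : Derivation ℂ B B) : d = 0 :=
  Derivation.ext fun x => hss _ fun φ =>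
    d.character_apply_eq_zero (d.continuous_of_characters_separate hss) φ x

/-- If all characters vanish at `z`, the powers of `z` decay faster than any geometric
sequence. -/
theorem exists_norm_pow_lt_of_characters_eq_zero {z : B} (hz : ∀ φ : B →ₐ[ℂ] ℂ, φ z = 0)
    {ε : ℝ} (hε : 0 < ε) : ∃ n : ℕ, 0 < n ∧ ‖z ^ n‖ < ε ^ n := by
  have hr : spectralRadius ℂ z = 0 := by
    rw [spectralRadius, ENNReal.iSup_eq_zero]
    intro k
    rw [ENNReal.iSup_eq_zero]
    intro hk
    obtain ⟨f, hf⟩ := WeakDual.CharacterSpace.mem_spectrum_iff_exists.1 hk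
    have := hz (WeakDual.CharacterSpace.equivAlgHom f)
    rw [WeakDual.CharacterSpace.equivAlgHom_coe, hf] at this
    simp [this]
  have hlim := spectrum.pow_norm_pow_one_div_tendsto_nhds_spectralRadius z
  rw [hr] at hlim
  obtain ⟨n, hn, hn0⟩ := ((hlim.eventually (gt_mem_nhds (ENNReal.ofReal_pos.2 hε))).and
    (Filter.eventually_gt_atTop 0)).exists
  refine ⟨n, hn0, ?_⟩
  have h := (ENNReal.ofReal_lt_ofReal_iff hε).1 hn
  calc ‖z ^ n‖ = (‖z ^ n‖ ^ (1 / n : ℝ)) ^ n := by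
        rw [one_div, Real.rpow_inv_natCast_pow (norm_nonneg _) hn0.ne']
    _ < ε ^ n := pow_lt_pow_left₀ h (by positivity) hn0.ne'

end Commutative

section Center

variable {A : Type*} [NormedRing A]

/-- A central element whose powers decay faster than any geometric sequence lies in the Jacobson
radical. -/
theorem mem_jacobson_of_central [CompleteSpace A] {z : A} (hz : ∀ a, Commute a z)
    (h : ∀ ε : ℝ, 0 < ε → ∃ n : ℕ, 0 < n ∧ ‖z ^ n‖ < ε ^ n) :
    z ∈ (⊥ : Ideal A).jacobson := by
  rw [Ideal.mem_jacobson_iff]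
  intro y
  obtain ⟨n, hn, hlt⟩ := h (‖y‖ + 1)⁻¹ (by positivity)
  have hw : ‖(-(y * z)) ^ n‖ < 1 := by
    have h₁ : (-(y * z)) ^ n = (-y) ^ n * z ^ n := by
      rw [← neg_mul, (hz (-y)).mul_pow]
    rw [h₁]
    calc ‖(-y) ^ n * z ^ n‖ ≤ ‖-y‖ ^ n * ‖z ^ n‖ :=
          (norm_mul_le _ _).trans (mul_le_mul_of_nonneg_right (norm_pow_le' _ hn) (norm_nonneg _))
      _ ≤ (‖y‖ + 1) ^ n * ‖z ^ n‖ := by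
          rw [norm_neg]
          gcongr
          linarith
      _ < (‖y‖ + 1) ^ n * (‖y‖ + 1)⁻¹ ^ n := by gcongr
      _ = 1 := by rw [← mul_pow, mul_inv_cancel₀ (by positivity), one_pow]
  obtain ⟨u, hu⟩ := isUnit_one_sub_of_norm_lt_one hw
  refine ⟨↑u⁻¹ * ∑ i ∈ Finset.range n, (-(y * z)) ^ i, ?_⟩
  rw [Ideal.mem_bot, sub_eq_zero]
  calc ↑u⁻¹ * (∑ i ∈ Finset.range n, (-(y * z)) ^ i) * y * z
        + ↑u⁻¹ * ∑ i ∈ Finset.range n, (-(y * z)) ^ i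
      = ↑u⁻¹ * ((∑ i ∈ Finset.range n, (-(y * z)) ^ i) * (1 - -(y * z))) := by noncomm_ring
    _ = 1 := by rw [geom_sum_mul_neg, ← hu, Units.inv_mul]

variable [NormedAlgebra ℂ A]

/-- The center of a normed algebra is a commutative normed ring. -/
abbrev Subalgebra.centerNormedCommRing : NormedCommRing (Subalgebra.center ℂ A) :=
  { (inferInstance : NormedRing (Subalgebra.center ℂ A)),
    (inferInstance : CommRing (Subalgebra.center ℂ A)) with }

end Center

/-- Let `A` be a semiprimitive (zero Jacobson radical) complex Banach
algebra and `d` a derivation of `A` with `[d x, x] = 0` for all `x`.  Then `d = 0`. -/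
theorem commuting_derivation_eq_zero
    (A : Type*) [NormedRing A] [NormedAlgebra ℂ A] [CompleteSpace A]
    (hsp : (⊥ : Ideal A).jacobson = ⊥)
    (d : A →ₗ[ℂ] A) (hleib : ∀ x y : A, d (x * y) = d x * y + x * d y)
    (hcomm : ∀ x : A, d x * x - x * d x = 0) :
    d = 0 := by
  have hcent : ∀ x y : A, d x * y = y * d x :=
    commute_of_commuting_derivation hsp d.toAddMonoidHom hleib hcomm
  have hmem (x : A) : d x ∈ Subalgebra.center ℂ A :=
    Subalgebra.mem_center_iff.2 fun y => (hcent x y).symm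
  let _ : NormedCommRing (Subalgebra.center ℂ A) := Subalgebra.centerNormedCommRing
  have hclosed : IsClosed (Subalgebra.center ℂ A : Set A) := by
    change IsClosed (Set.center A)
    rw [← Set.centralizer_univ]
    exact Set.isClosed_centralizer _
  have : CompleteSpace (Subalgebra.center ℂ A) := hclosed.completeSpace_coe
  have hss (z : Subalgebra.center ℂ A)
      (hz : ∀ φ : Subalgebra.center ℂ A →ₐ[ℂ] ℂ, φ z = 0) : z = 0 := by
    have : (z : A) ∈ (⊥ : Ideal A).jacobson :=
      mem_jacobson_of_central (fun a => Subalgebra.mem_center_iff.1 z.2 a) fun ε hε =>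
        exists_norm_pow_lt_of_characters_eq_zero hz hε
    rw [hsp, Ideal.mem_bot] at this
    exact Subtype.ext this
  let δ : Derivation ℂ (Subalgebra.center ℂ A) (Subalgebra.center ℂ A) :=
    Derivation.mk' ((d ∘ₗ (Subalgebra.center ℂ A).val.toLinearMap).codRestrict
      (Subalgebra.toSubmodule (Subalgebra.center ℂ A)) fun z => hmem z) fun x y => by
        refine Subtype.ext ?_
        change d ((x : A) * y) = x * d y + y * d x
        rw [hleib, hcent, add_comm]
  have hδ : δ = 0 := δ.eq_zero_of_characters_separate hss
  have hdd (x : A) : d (d x) = 0 :=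
    congrArg Subtype.val
      (DFunLike.congr_fun hδ (⟨d x, hmem x⟩ : Subalgebra.center ℂ A))
  ext x
  rw [LinearMap.zero_apply]
  refine eq_zero_of_mul_mul_self_eq_zero hsp fun w => ?_
  have hsq : d x * d x = 0 := by
    have h := hdd (x * x)
    simp only [hleib, map_add, hdd, zero_mul, mul_zero, zero_add, add_zero] at h
    have h2 : (2 : ℂ) • (d x * d x) = 0 := by rw [two_smul, h]
    exact (smul_eq_zero.1 h2).resolve_left two_ne_zero
  rw [hcent x w, mul_assoc, hsq, mul_zero]
end

section
/- Let B be a complex algebra and let θ : M₂(ℂ) → B be a linear map such that θ(1) lies in the center Z(B) of B, where 1 is the identity matrix. Then θ preserves commutativity: for all x, y ∈ M₂(ℂ), xy = yx implies θ(x)θ(y) = θ(y)θ(x). -/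
/-- If two `2 × 2` matrices over a field commute, then the first is scalar or the second is an
affine function of the first. -/
theorem Matrix.eq_smul_one_or_eq_add_smul_of_commute {K : Type*} [Field K]
    {x y : Matrix (Fin 2) (Fin 2) K} (h : Commute x y) :
    (∃ c : K, x = c • 1) ∨ ∃ a b : K, y = a • 1 + b • x := by
  have h00 := congrFun₂ h.eq 0 0
  have h01 := congrFun₂ h.eq 0 1
  have h10 := congrFun₂ h.eq 1 0
  simp only [Matrix.mul_apply, Fin.sum_univ_two] at h00 h01 h10
  by_cases hq : x 0 1 = 0
  · by_cases hr : x 1 0 = 0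
    · by_cases hd : x 0 0 - x 1 1 = 0
      · refine .inl ⟨x 0 0, ?_⟩
        ext i j
        fin_cases i <;> fin_cases j <;> simp <;> grind
      · refine .inr ⟨y 0 0 - (y 0 0 - y 1 1) / (x 0 0 - x 1 1) * x 0 0,
          (y 0 0 - y 1 1) / (x 0 0 - x 1 1), ?_⟩
        ext i j
        fin_cases i <;> fin_cases j <;> simp <;> grind
    · refine .inr ⟨y 0 0 - y 1 0 / x 1 0 * x 0 0, y 1 0 / x 1 0, ?_⟩
      ext i j
      fin_cases i <;> fin_cases j <;> simp <;> grind
  · refine .inr ⟨y 0 0 - y 0 1 / x 0 1 * x 0 0, y 0 1 / x 0 1, ?_⟩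
    ext i j
    fin_cases i <;> fin_cases j <;> simp <;> grind

/-- Let `B` be a complex algebra and `θ : M₂(ℂ) → B` a linear map
sending the identity matrix to a central element of `B`.  Then `θ` preserves
commutativity. -/
theorem linear_map_identity_to_center_preserves_commutativity
    (B : Type*) [NonUnitalRing B] [Module ℂ B] [IsScalarTower ℂ B B] [SMulCommClass ℂ B B]
    (θ : Matrix (Fin 2) (Fin 2) ℂ →ₗ[ℂ] B)
    (h1 : θ 1 ∈ Set.center B) :
    ∀ x y : Matrix (Fin 2) (Fin 2) ℂ, x * y = y * x → θ x * θ y = θ y * θ x := by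
  intro x y hxy
  have hc (b : B) : θ 1 * b = b * θ 1 := h1.comm b
  obtain ⟨c, rfl⟩ | ⟨a, b, rfl⟩ := Matrix.eq_smul_one_or_eq_add_smul_of_commute hxy
  · simp only [map_smul, smul_mul_assoc, mul_smul_comm, hc]
  · simp only [map_add, map_smul, mul_add, add_mul, smul_mul_assoc, mul_smul_comm, hc]
end

section
/- Let a, x, y ∈ M₂(ℂ) with xy = yx. Then the commutators [a,x] = ax − xa and [a,y] = ay − ya are linearly dependent over ℂ; in particular, [a,x] and [a,y] commute. Consequently, every derivation of M₂(ℂ) maps commuting pairs of matrices to commuting pairs. -/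
/-- Two commuting `2 × 2` matrices have a nontrivial linear combination that is scalar. -/
theorem exists_smul_add_smul_eq_smul_one_of_commute {K : Type*} [Field K]
    {x y : Matrix (Fin 2) (Fin 2) K} (hxy : x * y = y * x) :
    ∃ c d e : K, (c ≠ 0 ∨ d ≠ 0) ∧ c • x + d • y = e • 1 := by
  have h00 := congrFun (congrFun hxy 0) 0
  have h01 := congrFun (congrFun hxy 0) 1
  have h10 := congrFun (congrFun hxy 1) 0
  simp only [Matrix.mul_apply, Fin.sum_univ_two] at h00 h01 h10
  have key : ∀ c d : K, c * x 0 1 + d * y 0 1 = 0 → c * x 1 0 + d * y 1 0 = 0 →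
      c * (x 0 0 - x 1 1) + d * (y 0 0 - y 1 1) = 0 →
      c • x + d • y = (c * x 0 0 + d * y 0 0) • 1 := by
    intro c d h₁ h₂ h₃
    ext i j
    fin_cases i <;> fin_cases j <;> simp [h₁, h₂]
    linear_combination -h₃
  by_cases hp : x 0 1 = 0
  · by_cases hq : x 1 0 = 0
    · by_cases hr : x 0 0 - x 1 1 = 0
      · exact ⟨1, 0, _, by simp, key 1 0 (by simp [hp]) (by simp [hq]) (by simp [hr])⟩
      · exact ⟨-(y 0 0 - y 1 1), x 0 0 - x 1 1, _, .inr hr,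
          key _ _ (by linear_combination h01) (by linear_combination -h10) (by ring)⟩
    · exact ⟨-y 1 0, x 1 0, _, .inr hq,
        key _ _ (by linear_combination -h00) (by ring) (by linear_combination h10)⟩
  · exact ⟨-y 0 1, x 0 1, _, .inr hp,
      key _ _ (by ring) (by linear_combination h00) (by linear_combination -h01)⟩

/-- Linearly dependent elements of an algebra over a field commute. -/
theorem mul_comm_of_smul_add_smul_eq_zero {K A : Type*} [Field K] [Ring A] [Algebra K A]
    {p q : A} {c d : K} (hcd : c ≠ 0 ∨ d ≠ 0) (h : c • p + d • q = 0) : p * q = q * p := by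
  rcases hcd with hc | hd
  · have hp : p = (-(c⁻¹ * d)) • q := by
      rw [neg_smul, mul_smul, ← smul_neg, eq_inv_smul_iff₀ hc]
      exact eq_neg_of_add_eq_zero_left h
    rw [hp, smul_mul_assoc, mul_smul_comm]
  · have hq : q = (-(d⁻¹ * c)) • p := by
      rw [neg_smul, mul_smul, ← smul_neg, eq_inv_smul_iff₀ hd]
      exact eq_neg_of_add_eq_zero_right h
    rw [hq, smul_mul_assoc, mul_smul_comm]

/-- A derivation of `M₂(K)` maps commuting pairs to linearly dependent pairs. -/
theorem exists_smul_add_smul_eq_zero_of_leibniz {K : Type*} [Field K]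
    (D : Matrix (Fin 2) (Fin 2) K →ₗ[K] Matrix (Fin 2) (Fin 2) K)
    (hD : ∀ u v, D (u * v) = D u * v + u * D v)
    {x y : Matrix (Fin 2) (Fin 2) K} (hxy : x * y = y * x) :
    ∃ c d : K, (c ≠ 0 ∨ d ≠ 0) ∧ c • D x + d • D y = 0 := by
  obtain ⟨c, d, e, hcd, h⟩ := exists_smul_add_smul_eq_smul_one_of_commute hxy
  have hone : D 1 = 0 := by simpa using hD 1 1
  refine ⟨c, d, hcd, ?_⟩
  rw [← map_smul, ← map_smul, ← map_add, h, map_smul, hone, smul_zero]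

/-- If `a x y : M₂(ℂ)` and `x * y = y * x`, then the commutators
`[a,x]` and `[a,y]` are linearly dependent over `ℂ`; in particular they commute.
Consequently, every derivation of `M₂(ℂ)` maps commuting pairs to commuting pairs. -/
theorem matrix_two_commutators_linearly_dependent
    (a x y : Matrix (Fin 2) (Fin 2) ℂ) (hxy : x * y = y * x) :
    (∃ c d : ℂ, (c ≠ 0 ∨ d ≠ 0) ∧
        c • (a * x - x * a) + d • (a * y - y * a) = 0) ∧
    (a * x - x * a) * (a * y - y * a) = (a * y - y * a) * (a * x - x * a) ∧
    (∀ D : Matrix (Fin 2) (Fin 2) ℂ →ₗ[ℂ] Matrix (Fin 2) (Fin 2) ℂ,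
        (∀ u v, D (u * v) = D u * v + u * D v) →
        ∀ u v, u * v = v * u → D u * D v = D v * D u) := by
  have hinner : ∃ c d : ℂ, (c ≠ 0 ∨ d ≠ 0) ∧
      c • (a * x - x * a) + d • (a * y - y * a) = 0 :=
    exists_smul_add_smul_eq_zero_of_leibniz (LinearMap.mulLeft ℂ a - LinearMap.mulRight ℂ a)
      (fun u v => by
        simp only [LinearMap.sub_apply, LinearMap.mulLeft_apply, LinearMap.mulRight_apply]
        noncomm_ring) hxy
  refine ⟨hinner, ?_, fun D hD u v huv => ?_⟩
  · obtain ⟨c, d, hcd, h⟩ := hinner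
    exact mul_comm_of_smul_add_smul_eq_zero hcd h
  · obtain ⟨c, d, hcd, h⟩ := exists_smul_add_smul_eq_zero_of_leibniz D hD huv
    exact mul_comm_of_smul_add_smul_eq_zero hcd h
end

section
/- Let K be a field, A an associative K-algebra with center Z(A), and V a subspace of A such that A = V ⊕ Z(A) as vector spaces. Let γ : Z(A) → Z(A) be an injective linear map whose range Z₀ is a proper subspace of Z(A), let Z₁ be a subspace with Z(A) = Z₀ ⊕ Z₁, let J be an associative K-algebra, and let δ : J → Z₁ be a bijective linear map. Define θ : A × J → A (where A × J carries the product algebra structure) by θ(v + z, u) = v + γ(z) + δ(u) for v ∈ V, z ∈ Z(A), u ∈ J. Then θ is a bijective linear map that preserves commutativity (if (a,u) and (b,w) commute in A × J then θ(a,u) and θ(b,w) commute in A), and if J is not commutative then θ⁻¹ does not preserve commutativity. -/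
theorem Submodule.eq_and_eq_of_add_eq_add_of_disjoint {R M : Type*} [Ring R] [AddCommGroup M]
    [Module R M] {p q : Submodule R M} (h : Disjoint p q) {a a' : p} {b b' : q}
    (e : (a : M) + b = a' + b') : a = a' ∧ b = b' := by
  have hsub : ((a - a' : p) : M) = ((b' - b : q) : M) := by
    push_cast
    rw [sub_eq_sub_iff_add_eq_add, e, add_comm]
  have hzero : ((a - a' : p) : M) = 0 :=
    Submodule.disjoint_def.1 h _ (a - a').2 (hsub ▸ (b' - b).2)
  have ha : a = a' := sub_eq_zero.1 (Subtype.ext hzero)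
  subst ha
  exact ⟨rfl, Subtype.ext (add_left_cancel e)⟩

theorem commute_add_central_iff {A : Type*} [NonUnitalRing A] {x y c d : A}
    (hc : c ∈ Set.center A) (hd : d ∈ Set.center A) :
    Commute (x + c) (y + d) ↔ Commute x y := by
  have hcy : c * y = y * c := hc.comm y
  have hcd : c * d = d * c := hc.comm d
  have hdx : d * x = x * d := hd.comm x
  simp only [Commute, SemiconjBy, add_mul, mul_add, hcy, hcd, hdx]
  constructor
  · intro h
    have key : x * y + (y * c + (x * d + d * c)) = y * x + (y * c + (x * d + d * c)) := by
      convert h using 1 <;> abel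
    exact add_right_cancel key
  · intro h
    rw [h]
    abel

/-- Let `K` be a field, `A` an associative `K`-algebra whose center
(as a `K`-subspace `Zc`) has a vector-space complement `V` in `A`, let
`γ : Z(A) → Z(A)` be an injective linear map whose range is a proper subspace,
`Z₁` a complement of the range of `γ` in `Z(A)`, `J` an associative `K`-algebra, and
`δ : J ≃ Z₁` a linear bijection.  Define `θ : A × J → A` by
`θ (v + z, u) = v + γ z + δ u` for `v ∈ V`, `z ∈ Z(A)`, `u ∈ J`.  Then `θ` is a
bijective linear map preserving commutativity, and if `J` is not commutative then
`θ⁻¹` does not preserve commutativity. -/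
theorem one_directional_commutativity_preserver_example
    (K A J : Type*) [Field K]
    [NonUnitalRing A] [Module K A] [IsScalarTower K A A] [SMulCommClass K A A]
    [NonUnitalRing J] [Module K J] [IsScalarTower K J J] [SMulCommClass K J J]
    (Zc : Submodule K A) (hZc : (Zc : Set A) = Set.center A)
    (V : Submodule K A) (hcompl : IsCompl V Zc)
    (γ : Zc →ₗ[K] Zc) (hγinj : Function.Injective γ)
    (hγrange : LinearMap.range γ ≠ ⊤)
    (Z₁ : Submodule K Zc) (hZ₁ : IsCompl (LinearMap.range γ) Z₁)
    (δ : J ≃ₗ[K] Z₁)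
    (θ : A × J → A)
    (hθ : ∀ (v : V) (z : Zc) (u : J),
        θ ((v : A) + (z : A), u) = (v : A) + ((γ z : Zc) : A) + (((δ u : Z₁) : Zc) : A)) :
    Function.Bijective θ ∧
    (∀ p q : A × J, θ (p + q) = θ p + θ q) ∧
    (∀ (c : K) (p : A × J), θ (c • p) = c • θ p) ∧
    (∀ p q : A × J, p * q = q * p → θ p * θ q = θ q * θ p) ∧
    ((∃ u w : J, u * w ≠ w * u) →
        ∃ p q : A × J, θ p * θ q = θ q * θ p ∧ p * q ≠ q * p) := by
  have decomp : ∀ p : A × J, ∃ (v : V) (z : Zc) (u : J), p = ((v : A) + z, u) := by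
    rintro ⟨a, u⟩
    obtain ⟨v, z, h, -⟩ := Submodule.existsUnique_add_of_isCompl hcompl a
    exact ⟨v, z, u, by rw [h]⟩
  have central : ∀ z : Zc, (z : A) ∈ Set.center A := fun z => hZc ▸ z.2
  have hθ' : ∀ (v : V) (z : Zc) (u : J),
      θ ((v : A) + z, u) = (v : A) + ((γ z + (δ u : Zc) : Zc) : A) := by
    intro v z u
    rw [hθ, Submodule.coe_add, add_assoc]
  refine ⟨⟨?_, ?_⟩, ?_, ?_, ?_, ?_⟩
  · intro p q h
    obtain ⟨v, z, u, rfl⟩ := decomp p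
    obtain ⟨v', z', u', rfl⟩ := decomp q
    rw [hθ', hθ'] at h
    obtain ⟨rfl, hz⟩ := Submodule.eq_and_eq_of_add_eq_add_of_disjoint hcompl.disjoint h
    obtain ⟨hγ, hδ⟩ := Submodule.eq_and_eq_of_add_eq_add_of_disjoint hZ₁.disjoint
      (a := ⟨γ z, z, rfl⟩) (a' := ⟨γ z', z', rfl⟩) hz
    rw [hγinj (congrArg Subtype.val hγ), δ.injective hδ]
  · intro a
    obtain ⟨v, z, rfl, -⟩ := Submodule.existsUnique_add_of_isCompl hcompl a
    obtain ⟨⟨_, y, rfl⟩, w, rfl, -⟩ := Submodule.existsUnique_add_of_isCompl hZ₁ z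
    exact ⟨((v : A) + y, δ.symm w), by rw [hθ', δ.apply_symm_apply]⟩
  · intro p q
    obtain ⟨v, z, u, rfl⟩ := decomp p
    obtain ⟨v', z', u', rfl⟩ := decomp q
    have hsum : (((v : A) + z, u) + ((v' : A) + z', u') : A × J) =
        (((v + v' : V) : A) + ((z + z' : Zc) : A), u + u') := by
      ext
      · push_cast
        exact add_add_add_comm _ _ _ _
      · rfl
    rw [hsum, hθ, hθ, hθ]
    simp only [map_add, Submodule.coe_add]
    abel
  · intro c p
    obtain ⟨v, z, u, rfl⟩ := decomp p
    have hsmul : (c • ((v : A) + z, u) : A × J) =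
        (((c • v : V) : A) + ((c • z : Zc) : A), c • u) := by
      ext
      · exact smul_add _ _ _
      · rfl
    rw [hsmul, hθ, hθ]
    simp only [map_smul, Submodule.coe_smul, smul_add]
  · intro p q h
    obtain ⟨v, z, u, rfl⟩ := decomp p
    obtain ⟨v', z', u', rfl⟩ := decomp q
    rw [hθ', hθ']
    have hcomm : Commute ((v : A) + z) ((v' : A) + z') := congrArg Prod.fst h
    exact (commute_add_central_iff (central _) (central _)).2
      ((commute_add_central_iff (central _) (central _)).1 hcomm)
  · rintro ⟨u, w, huw⟩
    refine ⟨(((0 : V) : A) + ((0 : Zc) : A), u), (((0 : V) : A) + ((0 : Zc) : A), w), ?_,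
      fun h => huw (congrArg Prod.snd h)⟩
    rw [hθ', hθ']
    exact (commute_add_central_iff (central _) (central _)).2 (Commute.refl _)
end

section
/- Let A be a semiprime ring and let f : A → A be a commuting additive map, i.e., [f(x),x] = 0 for all x ∈ A. Then f([x,y]) − [x, f(y)] ∈ Z(A) for all x, y ∈ A. -/
section Semiprime

variable {A : Type*} [NonUnitalRing A]

/-- The two-sided ideal of the elements annihilating `a` and `A * a` from the left. -/
def leftAnnihilatorIdeal (a : A) : TwoSidedIdeal A :=
  .mk' {b | b * a = 0 ∧ ∀ z, b * z * a = 0}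
    (by simp)
    (fun hx hy => ⟨by rw [add_mul, hx.1, hy.1, add_zero], fun z => by
      rw [add_mul, add_mul, hx.2, hy.2, add_zero]⟩)
    (fun hx => ⟨by rw [neg_mul, hx.1, neg_zero], fun z => by
      rw [neg_mul, neg_mul, hx.2, neg_zero]⟩)
    (fun {x y} hy => ⟨by rw [mul_assoc, hy.1, mul_zero], fun z => by
      rw [mul_assoc x y z, mul_assoc x, hy.2, mul_zero]⟩)
    (fun {x y} hx => ⟨hx.2 y, fun z => by rw [mul_assoc x y z, hx.2]⟩)

theorem mem_leftAnnihilatorIdeal {a b : A} :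
    b ∈ leftAnnihilatorIdeal a ↔ b * a = 0 ∧ ∀ z, b * z * a = 0 := by
  simp [leftAnnihilatorIdeal]

/-- The elements of the two-sided ideal `I` annihilated by `I` from the left. -/
def TwoSidedIdeal.selfAnnihilator (I : TwoSidedIdeal A) : TwoSidedIdeal A :=
  .mk' {c | c ∈ I ∧ ∀ b ∈ I, b * c = 0}
    (by simp [I.zero_mem])
    (fun hx hy => ⟨I.add_mem hx.1 hy.1, fun b hb => by
      rw [mul_add, hx.2 b hb, hy.2 b hb, add_zero]⟩)
    (fun hx => ⟨I.neg_mem hx.1, fun b hb => by rw [mul_neg, hx.2 b hb, neg_zero]⟩)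
    (fun {x y} hy => ⟨I.mul_mem_left x y hy.1, fun b hb => by
      rw [← mul_assoc, hy.2 _ (I.mul_mem_right b x hb)]⟩)
    (fun {x y} hx => ⟨I.mul_mem_right x y hx.1, fun b hb => by
      rw [← mul_assoc, hx.2 b hb, zero_mul]⟩)

theorem TwoSidedIdeal.mem_selfAnnihilator {I : TwoSidedIdeal A} {c : A} :
    c ∈ I.selfAnnihilator ↔ c ∈ I ∧ ∀ b ∈ I, b * c = 0 := by
  simp [TwoSidedIdeal.selfAnnihilator]

theorem eq_zero_of_mul_self_of_mul_mul_self
    (hsemi : ∀ I : TwoSidedIdeal A, (∀ x ∈ I, ∀ y ∈ I, x * y = 0) → I = ⊥)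
    {a : A} (h : a * a = 0) (h' : ∀ z, a * z * a = 0) : a = 0 := by
  have hbot := hsemi (leftAnnihilatorIdeal a).selfAnnihilator fun x hx y hy =>
    (TwoSidedIdeal.mem_selfAnnihilator.1 hy).2 x (TwoSidedIdeal.mem_selfAnnihilator.1 hx).1
  have ha : a ∈ (leftAnnihilatorIdeal a).selfAnnihilator :=
    TwoSidedIdeal.mem_selfAnnihilator.2 ⟨mem_leftAnnihilatorIdeal.2 ⟨h, h'⟩,
      fun b hb => (mem_leftAnnihilatorIdeal.1 hb).1⟩
  rwa [hbot, TwoSidedIdeal.mem_bot] at ha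

end Semiprime

section Commuting

variable {A : Type*} [NonUnitalRing A] {f : A →+ A}

theorem commuting_linearized (hf : ∀ x : A, f x * x - x * f x = 0) (x y : A) :
    f x * y - y * f x = x * f y - f y * x := by
  have h := hf (x + y)
  have hx := hf x
  have hy := hf y
  rw [map_add] at h
  rw [← sub_eq_zero]
  calc _ = (f x + f y) * (x + y) - (x + y) * (f x + f y) - (f x * x - x * f x)
        - (f y * y - y * f y) := by noncomm_ring
    _ = 0 := by rw [h, hx, hy]; simp

/-- For a commuting additive map `f`, the biderivation `D x y = [f x, y]` satisfies
`D x y * [u, v] = [x, y] * D u v`. -/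
theorem commuting_mul_commutator (hf : ∀ x : A, f x * x - x * f x = 0) (x y u v : A) :
    (f x * y - y * f x) * (u * v - v * u) = (x * y - y * x) * (f u * v - v * f u) := by
  have key := commuting_linearized hf (x * u) (y * v)
  have h₁ := commuting_linearized hf (x * u) y
  have h₂ := commuting_linearized hf (x * u) v
  have h₃ := commuting_linearized hf x (y * v)
  have h₄ := commuting_linearized hf u (y * v)
  have h₅ := commuting_linearized hf x y
  have h₆ := commuting_linearized hf x v
  have h₇ := commuting_linearized hf u y
  have h₈ := commuting_linearized hf u v
  have first : f (x * u) * (y * v) - y * v * f (x * u) =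
      ((f x * y - y * f x) * v + y * (f x * v - v * f x)) * u
        + x * ((f u * y - y * f u) * v + y * (f u * v - v * f u)) := by
    calc _ = (x * f (y * v) - f (y * v) * x) * u + x * (u * f (y * v) - f (y * v) * u) := by
          rw [key]; noncomm_ring
      _ = _ := by rw [← h₃, ← h₄]; noncomm_ring
  have second : f (x * u) * (y * v) - y * v * f (x * u) =
      ((f x * y - y * f x) * u + x * (f u * y - y * f u)) * v
        + y * ((f x * v - v * f x) * u + x * (f u * v - v * f u)) := by
    calc _ = (f (x * u) * y - y * f (x * u)) * v + y * (f (x * u) * v - v * f (x * u)) := by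
          noncomm_ring
      _ = _ := by rw [h₁, h₂, h₅, h₆, h₇, h₈]; noncomm_ring
  have h := first.symm.trans second
  generalize f x * y - y * f x = d₁ at h ⊢
  generalize f u * v - v * f u = d₂ at h ⊢
  generalize f x * v - v * f x = d₃ at h
  generalize f u * y - y * f u = d₄ at h
  rw [← sub_eq_zero] at h ⊢
  rw [← neg_eq_zero, ← h]
  noncomm_ring

theorem commuting_mul_mul_commutator (hf : ∀ x : A, f x * x - x * f x = 0) (x y z u v : A) :
    (f x * y - y * f x) * z * (u * v - v * u) =
      (x * y - y * x) * z * (f u * v - v * f u) := by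
  have h := commuting_mul_commutator hf x y (z * u) v
  have h' := commuting_mul_commutator hf x y z v
  have hzu : f (z * u) * v - v * f (z * u) =
      (f z * v - v * f z) * u + z * (f u * v - v * f u) := by
    rw [commuting_linearized hf (z * u) v, commuting_linearized hf z v,
      commuting_linearized hf u v]
    noncomm_ring
  rw [hzu] at h
  calc _ = (f x * y - y * f x) * (z * u * v - v * (z * u))
        - (f x * y - y * f x) * (z * v - v * z) * u := by noncomm_ring
    _ = _ := by rw [h, h']; noncomm_ring

end Commuting

/-- Let `A` be a semiprime ring (no nonzero two-sided ideal squares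
to zero) and `f : A → A` a commuting additive map, i.e. `[f x, x] = 0` for all `x`.
Then `f [x,y] - [x, f y] ∈ Z(A)` for all `x y : A`. -/
theorem commuting_additive_map_functional_identity
    (A : Type*) [NonUnitalRing A]
    (hsemi : ∀ I : TwoSidedIdeal A, (∀ x ∈ I, ∀ y ∈ I, x * y = 0) → I = ⊥)
    (f : A →+ A) (hf : ∀ x : A, f x * x - x * f x = 0) :
    ∀ x y : A, f (x * y - y * x) - (x * f y - f y * x) ∈ Set.center A := by
  intro x y
  rw [Semigroup.mem_center_iff]
  intro w
  set g := f (x * y - y * x) - (x * f y - f y * x) with hg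
  have hxy := commuting_linearized hf x y
  have hE : g * w - w * g = (f (x * y - y * x) * w - w * f (x * y - y * x))
      - ((f x * y - y * f x) * w - w * (f x * y - y * f x)) := by
    rw [hxy, hg]
    noncomm_ring
  have mul_commutator : ∀ u v, (g * w - w * g) * (u * v - v * u) = 0 := fun u v => by
    have h₁ := commuting_mul_commutator hf (x * y - y * x) w u v
    have h₂ := commuting_mul_mul_commutator hf x y w u v
    have h₃ := commuting_mul_commutator hf x y u v
    have expand : ((f x * y - y * f x) * w - w * (f x * y - y * f x)) * (u * v - v * u) =
        (f x * y - y * f x) * w * (u * v - v * u)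
          - w * ((f x * y - y * f x) * (u * v - v * u)) := by
      rw [sub_mul, mul_assoc w]
    rw [hE, sub_mul, h₁, expand, h₂, h₃]
    noncomm_ring
  have mul_mul_commutator : ∀ z u v, (g * w - w * g) * z * (u * v - v * u) = 0 := fun z u v => by
    have h₁ := commuting_mul_mul_commutator hf (x * y - y * x) w z u v
    have h₂ := commuting_mul_mul_commutator hf x y (w * z) u v
    have h₃ := commuting_mul_mul_commutator hf x y z u v
    have expand : ((f x * y - y * f x) * w - w * (f x * y - y * f x)) * z * (u * v - v * u) =
        (f x * y - y * f x) * (w * z) * (u * v - v * u)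
          - w * ((f x * y - y * f x) * z * (u * v - v * u)) := by
      rw [sub_mul, sub_mul, mul_assoc _ w z, mul_assoc w, mul_assoc w]
    rw [hE, sub_mul, sub_mul, h₁, expand, h₂, h₃]
    noncomm_ring
  have hzero : g * w - w * g = 0 :=
    eq_zero_of_mul_self_of_mul_mul_self hsemi (mul_commutator g w) fun z => mul_mul_commutator z g w
  exact (sub_eq_zero.1 hzero).symm
end
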